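/- arXiv:2508.11448 — 5 statements merged into one kernel-verified Lean document; each statement's English description precedes it below -/
import Mathlib

section
/- Let V be an irreducible cuspidal Harish-Chandra module over τ(B) and let 𝔐 be a cofinite ideal of B with (τ ⊗ 𝔐²)·V = 0. Then there exists P ∈ ℕ such that any composition of P operators from τ ⊗ 𝔐 annihilates V; that is, (X_1 ⊗ a_1)(X_2 ⊗ a_2)⋯(X_P ⊗ a_P)·V = 0 for all X_1,…,X_P ∈ τ and a_1,…,a_P ∈ 𝔐. -/
open scoped TensorProduct

namespace MT

/-- Presentation of the full toroidal Lie algebra `τ` of rank `n` associated with the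
finite-dimensional simple complex Lie algebra `𝔤`, the invariant form `κ` and the
2-cocycle `φ = c₁ • φ₁ + c₂ • φ₂`.  Here `E m x` stands for `x ⊗ t^m`, `K m i` for
`t^m K_i` (the image in the space of Kähler differentials `𝒦 = Ω/dA_n`), and
`W m i` for `t^m d_i`. -/
structure IsFullToroidal (n : ℕ) (𝔤 : Type) [LieRing 𝔤] [LieAlgebra ℂ 𝔤]
    (τ : Type) [LieRing τ] [LieAlgebra ℂ τ]
    (κ : 𝔤 →ₗ[ℂ] 𝔤 →ₗ[ℂ] ℂ) (c₁ c₂ : ℂ)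
    (E : (Fin n → ℤ) → 𝔤 →ₗ[ℂ] τ) (K W : (Fin n → ℤ) → Fin n → τ) : Prop where
  κ_symm : ∀ x y, κ x y = κ y x
  κ_invariant : ∀ x y z, κ ⁅x, y⁆ z = κ x ⁅y, z⁆
  κ_nondeg : ∀ x, (∀ y, κ x y = 0) → x = 0
  span_eq_top : Submodule.span ℂ
      ({z : τ | ∃ m x, z = E m x} ∪ {z : τ | ∃ m i, z = K m i} ∪
        {z : τ | ∃ m i, z = W m i}) = ⊤
  K_rel : ∀ m : Fin n → ℤ, (∑ i, (m i : ℂ) • K m i) = 0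
  lie_E_E : ∀ m k x y, ⁅E m x, E k y⁆
      = E (m + k) ⁅x, y⁆ + κ x y • ∑ i, (m i : ℂ) • K (m + k) i
  lie_E_K : ∀ m x k j, ⁅E m x, K k j⁆ = 0
  lie_K_K : ∀ m i k j, ⁅K m i, K k j⁆ = 0
  lie_W_E : ∀ m i k x, ⁅W m i, E k x⁆ = (k i : ℂ) • E (m + k) x
  lie_W_K : ∀ m i k j, ⁅W m i, K k j⁆
      = (k i : ℂ) • K (m + k) j + (if i = j then ∑ p, (m p : ℂ) • K (m + k) p else 0)
  lie_W_W : ∀ m i k j, ⁅W m i, W k j⁆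
      = (k i : ℂ) • W (m + k) j - (m j : ℂ) • W (m + k) i
        + (c₁ * (-((k i : ℂ) * (m j : ℂ))) + c₂ * ((m i : ℂ) * (k j : ℂ)))
          • ∑ p, (m p : ℂ) • K (m + k) p

/-- The map algebra `τ(B) = τ ⊗ B` is a complex Lie algebra. -/
noncomputable instance mapLieAlgebra (B τ : Type) [CommRing B] [Algebra ℂ B]
    [LieRing τ] [LieAlgebra ℂ τ] : LieAlgebra ℂ (B ⊗[ℂ] τ) :=
  { (inferInstance : Module ℂ (B ⊗[ℂ] τ)) with
    lie_smul := fun c x y => by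
      rw [← algebraMap_smul B c y, lie_smul, algebraMap_smul] }

/-- The simultaneous eigenspace ("weight space") of the commuting family of
operators `d` for the eigenvalue function `l`. -/
def weightSpace {n : ℕ} {L V : Type*} [LieRing L] [LieAlgebra ℂ L] [AddCommGroup V]
    [Module ℂ V] [LieRingModule L V] [LieModule ℂ L V]
    (d : Fin n → L) (l : Fin n → ℂ) : Submodule ℂ V where
  carrier := {v | ∀ i, ⁅d i, v⁆ = l i • v}
  add_mem' := by
    intro a b ha hb i
    rw [lie_add, ha i, hb i, smul_add]
  zero_mem' := by
    intro i
    rw [lie_zero, smul_zero]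
  smul_mem' := by
    intro c a ha i
    rw [lie_smul, ha i, smul_comm]

/-- `V` is a Harish-Chandra module with respect to the degree operators `d`:
the sum of the weight spaces is all of `V` and each weight space is finite
dimensional. -/
def IsHarishChandra {n : ℕ} {L V : Type*} [LieRing L] [LieAlgebra ℂ L] [AddCommGroup V]
    [Module ℂ V] [LieRingModule L V] [LieModule ℂ L V] (d : Fin n → L) : Prop :=
  (⨆ l : Fin n → ℂ, weightSpace (V := V) d l) = ⊤ ∧
    ∀ l : Fin n → ℂ, FiniteDimensional ℂ (weightSpace (V := V) d l)

/-- `V` is cuspidal (uniformly bounded): a Harish-Chandra module whose weight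
space dimensions admit a uniform bound. -/
def IsCuspidal {n : ℕ} {L V : Type*} [LieRing L] [LieAlgebra ℂ L] [AddCommGroup V]
    [Module ℂ V] [LieRingModule L V] [LieModule ℂ L V] (d : Fin n → L) : Prop :=
  IsHarishChandra (V := V) d ∧
    ∃ N : ℕ, ∀ l : Fin n → ℂ, Module.finrank ℂ (weightSpace (V := V) d l) ≤ N

/-- The degree operators `d_i ⊗ 1` inside `τ(B)`. -/
noncomputable def dOp {n : ℕ} (B : Type) [CommRing B] [Algebra ℂ B] {τ : Type}
    [LieRing τ] [LieAlgebra ℂ τ] (W : (Fin n → ℤ) → Fin n → τ) (i : Fin n) :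
    B ⊗[ℂ] τ :=
  (1 : B) ⊗ₜ[ℂ] W 0 i

variable {n : ℕ} {𝔤 : Type} [LieRing 𝔤] [LieAlgebra ℂ 𝔤]
variable {τ : Type} [LieRing τ] [LieAlgebra ℂ τ]

/-- The set of homogeneous generators of `τ` of degree `m`. -/
def genOfDeg (E : (Fin n → ℤ) → 𝔤 →ₗ[ℂ] τ) (K W : (Fin n → ℤ) → Fin n → τ)
    (m : Fin n → ℤ) : Set τ :=
  Set.range (E m) ∪ Set.range (K m) ∪ Set.range (W m)

/-- The homogeneous generators of `τ` of degree lying in the subgroup `M`,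
i.e. generators of `τ_M`. -/
def tauMGens (E : (Fin n → ℤ) → 𝔤 →ₗ[ℂ] τ) (K W : (Fin n → ℤ) → Fin n → τ)
    (M : AddSubgroup (Fin n → ℤ)) : Set τ :=
  {Y | ∃ m ∈ M, Y ∈ genOfDeg E K W m}

/-- The graded piece `τ_m`. -/
def gradedPiece (E : (Fin n → ℤ) → 𝔤 →ₗ[ℂ] τ) (K W : (Fin n → ℤ) → Fin n → τ)
    (m : Fin n → ℤ) : Submodule ℂ τ :=
  Submodule.span ℂ (genOfDeg E K W m)

/-- The subalgebra `τ(B)_M = ⊕_{m ∈ M} τ_m ⊗ B` of `τ(B)`. -/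
noncomputable def tauBM (B : Type) [CommRing B] [Algebra ℂ B]
    (E : (Fin n → ℤ) → 𝔤 →ₗ[ℂ] τ) (K W : (Fin n → ℤ) → Fin n → τ)
    (M : AddSubgroup (Fin n → ℤ)) : LieSubalgebra ℂ (B ⊗[ℂ] τ) :=
  LieSubalgebra.lieSpan ℂ (B ⊗[ℂ] τ)
    {z | ∃ (a : B) (Y : τ), Y ∈ tauMGens E K W M ∧ z = a ⊗ₜ[ℂ] Y}

/-- The degree operators `d_i ⊗ 1` as elements of `τ(B)_M` (note `0 ∈ M`). -/
noncomputable def dOpM (B : Type) [CommRing B] [Algebra ℂ B]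
    (E : (Fin n → ℤ) → 𝔤 →ₗ[ℂ] τ) (K W : (Fin n → ℤ) → Fin n → τ)
    (M : AddSubgroup (Fin n → ℤ)) (i : Fin n) : ↥(tauBM B E K W M) :=
  ⟨(1 : B) ⊗ₜ[ℂ] W 0 i,
    LieSubalgebra.subset_lieSpan
      ⟨1, W 0 i, ⟨0, M.zero_mem, Or.inr ⟨i, rfl⟩⟩, rfl⟩⟩

/-- `(τ ⊗ I)·V = 0`. -/
def annTensor (τ : Type) [LieRing τ] [LieAlgebra ℂ τ] (B : Type) [CommRing B]
    [Algebra ℂ B] (I : Ideal B) (V : Type) [AddCommGroup V] [Module ℂ V]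
    [LieRingModule (B ⊗[ℂ] τ) V] : Prop :=
  ∀ X : τ, ∀ a ∈ I, ∀ v : V, ⁅a ⊗ₜ[ℂ] X, v⁆ = 0

/-- The action of `τ(B)` on `V` is by evaluation at the algebra homomorphism
`ψ : B → ℂ`:  `(X ⊗ b)·v = ψ(b) (X ⊗ 1)·v`. -/
def evalActs (τ : Type) [LieRing τ] [LieAlgebra ℂ τ] (B : Type) [CommRing B]
    [Algebra ℂ B] (ψ : B →ₐ[ℂ] ℂ) (V : Type) [AddCommGroup V] [Module ℂ V]
    [LieRingModule (B ⊗[ℂ] τ) V] : Prop :=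
  ∀ (X : τ) (b : B) (v : V), ⁅b ⊗ₜ[ℂ] X, v⁆ = ψ b • ⁅(1 : B) ⊗ₜ[ℂ] X, v⁆

/-- `v` is annihilated by `τ(B)^+_M = ⊕_{m ∈ M, r ≥ 1} τ(B)_{m + rβ}`. -/
def annPlus (B : Type) [CommRing B] [Algebra ℂ B]
    (E : (Fin n → ℤ) → 𝔤 →ₗ[ℂ] τ) (K W : (Fin n → ℤ) → Fin n → τ)
    (M : AddSubgroup (Fin n → ℤ)) (β : Fin n → ℤ) {V : Type} [AddCommGroup V]
    [Module ℂ V] [LieRingModule (B ⊗[ℂ] τ) V] (v : V) : Prop :=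
  ∀ m₀ ∈ M, ∀ r : ℕ, 0 < r → ∀ a : B,
    (∀ x : 𝔤, ⁅a ⊗ₜ[ℂ] E (m₀ + (r : ℤ) • β) x, v⁆ = 0) ∧
    (∀ i : Fin n, ⁅a ⊗ₜ[ℂ] K (m₀ + (r : ℤ) • β) i, v⁆ = 0) ∧
    (∀ i : Fin n, ⁅a ⊗ₜ[ℂ] W (m₀ + (r : ℤ) • β) i, v⁆ = 0)

/-- Successive action of a list of Lie algebra elements on a module vector:
`actList [x₁, …, x_r] v = x₁ · (x₂ ⋯ (x_r · v))`. -/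
def actList {L V : Type*} [LieRing L] [AddCommGroup V] [LieRingModule L V] :
    List L → V → V
  | [], v => v
  | x :: xs, v => ⁅x, actList xs v⁆

/-- `V` is a highest weight module for `τ(B)`:  there are `M ≤ ℤⁿ` and `β ∈ ℤⁿ`
with `ℤⁿ = M ⊕ ℤβ` and a nonzero `v ∈ V` with `τ(B)^+_M · v = 0` which
generates `V` over `U(τ(B))`. -/
def IsHighestWeightModule (B : Type) [CommRing B] [Algebra ℂ B]
    (E : (Fin n → ℤ) → 𝔤 →ₗ[ℂ] τ) (K W : (Fin n → ℤ) → Fin n → τ)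
    (V : Type) [AddCommGroup V] [Module ℂ V] [LieRingModule (B ⊗[ℂ] τ) V]
    [LieModule ℂ (B ⊗[ℂ] τ) V] : Prop :=
  ∃ (M : AddSubgroup (Fin n → ℤ)) (β : Fin n → ℤ),
    IsCompl M (AddSubgroup.zmultiples β) ∧
    ∃ v : V, v ≠ 0 ∧ annPlus B E K W M β v ∧
      LieSubmodule.lieSpan ℂ (B ⊗[ℂ] τ) {v} = ⊤

/-- Linear independence properties of the generators of the full toroidal Lie
algebra: the only linear relations among the homogeneous generators are the
Kähler relations `∑ᵢ mᵢ t^m K_i = 0`. -/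
structure FreeGens (E : (Fin n → ℤ) → 𝔤 →ₗ[ℂ] τ) (K W : (Fin n → ℤ) → Fin n → τ) :
    Prop where
  K_indep : ∀ (m : Fin n → ℤ) (c : Fin n → ℂ), (∑ i, c i • K m i) = 0 →
      ∃ t : ℂ, ∀ i, c i = t * (m i : ℂ)
  W_indep : ∀ (m : Fin n → ℤ) (c : Fin n → ℂ), (∑ i, c i • W m i) = 0 → ∀ i, c i = 0
  E_inj : ∀ (m : Fin n → ℤ) (x : 𝔤), E m x = 0 → x = 0
  EKW_indep : ∀ (m : Fin n → ℤ) (x : 𝔤) (c d : Fin n → ℂ),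
      E m x + (∑ i, c i • K m i) + (∑ i, d i • W m i) = 0 →
      x = 0 ∧ (∀ i, d i = 0) ∧ ∃ t : ℂ, ∀ i, c i = t * (m i : ℂ)
  graded_indep : ∀ m : Fin n → ℤ,
      gradedPiece E K W m ⊓ (⨆ k : Fin n → ℤ, ⨆ _ : k ≠ m, gradedPiece E K W k) = ⊥

section Nilpotency

open Module

lemma mul_pow_succ_of_mul_eq {R : Type*} [Ring R] {r T g : R} (h : r * T = T * r + g)
    (hc : Commute T g) (s : ℕ) :
    r * T ^ (s + 1) = T ^ (s + 1) * r + ((s + 1 : ℕ) : R) * (T ^ s * g) := by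
  induction s with
  | zero => simpa using h
  | succ s ih =>
    have hg : g * T = T * g := hc.eq.symm
    calc r * T ^ (s + 1 + 1) = r * T ^ (s + 1) * T := by rw [pow_succ, mul_assoc]
      _ = T ^ (s + 1) * (r * T) + ((s + 1 : ℕ) : R) * (T ^ s * (g * T)) := by
        rw [ih, add_mul]; simp only [mul_assoc]
      _ = T ^ (s + 1 + 1) * r + ((s + 1 + 1 : ℕ) : R) * (T ^ (s + 1) * g) := by
        rw [h, hg, ← mul_assoc (T ^ s) T g, ← pow_succ, mul_add, ← mul_assoc, ← pow_succ]
        push_cast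
        noncomm_ring

/-- If the commutator of `r` with a nilpotent element `T` is a scalar multiple of `y`, and `y`
commutes with both, then `y` is nilpotent. -/
lemma isNilpotent_of_commutator_smul {A : Type*} [Ring A] [Algebra ℂ A] {r T y : A} {c : ℂ}
    (hc : c ≠ 0) (h : r * T = T * r + c • y) (hTy : Commute T y) (hry : Commute r y)
    (hT : IsNilpotent T) : IsNilpotent y := by
  obtain ⟨N, hN⟩ := hT
  have key : ∀ k ≤ N, T ^ (N - k) * y ^ k = 0 := by
    intro k
    induction k with
    | zero => intro _; simpa using hN
    | succ k ih =>
      intro hk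
      have h1 := ih (by omega)
      obtain ⟨s, hs⟩ : ∃ s, N - k = s + 1 := ⟨N - k - 1, by omega⟩
      have hs' : N - (k + 1) = s := by omega
      rw [hs] at h1
      rw [hs']
      have h2 : r * (T ^ (s + 1) * y ^ k) = 0 := by rw [h1, mul_zero]
      rw [← mul_assoc, mul_pow_succ_of_mul_eq h (hTy.smul_right c), add_mul, mul_assoc _ r,
        (hry.pow_right k).eq, ← mul_assoc, h1, zero_mul, zero_add, mul_smul_comm, mul_smul_comm,
        smul_mul_assoc, smul_eq_zero_iff_right hc, mul_assoc, mul_assoc, ← pow_succ',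
        ← map_natCast (algebraMap ℂ A), ← Algebra.smul_def,
        smul_eq_zero_iff_right (Nat.cast_ne_zero.2 s.succ_ne_zero)] at h2
      exact h2
  exact ⟨N, by simpa using key N le_rfl⟩

/-- If `r * y - y * r = h` where `y` is nilpotent and commutes with `h`, and `h` has a single
generalized eigenvalue, then `h` is nilpotent. -/
lemma isNilpotent_commutator {A : Type*} [Ring A] [Nontrivial A] [Algebra ℂ A] {r y h : A}
    (hr : r * y = y * r + h) (hyh : Commute y h) (hy : IsNilpotent y) {μ : ℂ}
    (hμ : IsNilpotent (h - algebraMap ℂ A μ)) : IsNilpotent h := by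
  rcases eq_or_ne μ 0 with rfl | hμ0
  · simpa using hμ
  exfalso
  have hu : IsUnit h := by
    have := hμ.isUnit_add_left_of_commute (u := algebraMap ℂ A μ)
      ((IsUnit.mk0 μ hμ0).map _) (Algebra.commutes μ _).symm
    simpa using this
  obtain ⟨N, hN⟩ := hy
  have key : ∀ k ≤ N, y ^ (N - k) = 0 := by
    intro k
    induction k with
    | zero => intro _; simpa using hN
    | succ k ih =>
      intro hk
      have h1 := ih (by omega)
      obtain ⟨s, hs⟩ : ∃ s, N - k = s + 1 := ⟨N - k - 1, by omega⟩
      have hs' : N - (k + 1) = s := by omega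
      rw [hs] at h1
      rw [hs']
      have h2 : r * y ^ (s + 1) = 0 := by rw [h1, mul_zero]
      rw [mul_pow_succ_of_mul_eq hr hyh, h1, zero_mul, zero_add,
        ← map_natCast (algebraMap ℂ A), ← Algebra.smul_def,
        smul_eq_zero_iff_right (Nat.cast_ne_zero.2 s.succ_ne_zero)] at h2
      exact (hu.mul_left_eq_zero).1 h2
  have := key N le_rfl
  simp at this

lemma isNilpotent_of_mem_span {A : Type*} [Ring A] [Algebra ℂ A] {τ : Type*} [AddCommGroup τ]
    [Module ℂ τ] (F : τ →ₗ[ℂ] A) (hF : ∀ X Y, Commute (F X) (F Y)) {S : Set τ}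
    (hS : ∀ X ∈ S, IsNilpotent (F X)) {X : τ} (hX : X ∈ Submodule.span ℂ S) :
    IsNilpotent (F X) := by
  induction hX using Submodule.span_induction with
  | mem X h => exact hS X h
  | zero => simp
  | add X Y _ _ hX hY => rw [map_add]; exact (hF X Y).isNilpotent_add hX hY
  | smul c X _ hX => rw [map_smul]; exact hX.smul c

/-- A product of at least `dim U` pairwise commuting nilpotent operators preserving `U`
vanishes on `U`. -/
lemma prod_apply_eq_zero_of_finrank_le {V : Type*} [AddCommGroup V] [Module ℂ V]
    (l : List (End ℂ V)) (hcomm : ∀ S ∈ l, ∀ T ∈ l, Commute S T)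
    (hnil : ∀ S ∈ l, IsNilpotent S) (U : Submodule ℂ V) [FiniteDimensional ℂ U]
    (hU : ∀ S ∈ l, ∀ u ∈ U, S u ∈ U) (hl : finrank ℂ U ≤ l.length) :
    ∀ u ∈ U, l.reverse.prod u = 0 := by
  induction l generalizing U with
  | nil =>
    intro u hu
    have : U = ⊥ := Submodule.finrank_eq_zero.1 (by simpa using hl)
    subst this
    simpa using hu
  | cons T l ih =>
    intro u hu
    have hle : U.map T ≤ U := by
      rintro _ ⟨w, hw, rfl⟩
      exact hU T (by simp) w hw
    have hfd : FiniteDimensional ℂ (U.map T) := inferInstance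
    have hdim : finrank ℂ (U.map T) ≤ l.length := by
      by_cases hbot : U = ⊥
      · rw [hbot, Submodule.map_bot, finrank_bot]; exact Nat.zero_le _
      · have hlt : U.map T < U := by
          refine lt_of_le_of_ne hle fun heq => hbot ?_
          obtain ⟨k, hk⟩ := hnil T (by simp)
          have hpow : ∀ k : ℕ, U.map (T ^ k) = U := by
            intro k
            induction k with
            | zero => exact Submodule.map_id U
            | succ k ih =>
              rw [pow_succ, Module.End.mul_eq_comp, Submodule.map_comp, heq, ih]
          have := hpow k
          rw [hk] at this
          rw [← this]
          exact Submodule.map_zero U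
        have := Submodule.finrank_lt_finrank_of_lt hlt
        simp only [List.length_cons] at hl
        omega
    have := ih (fun S hS T hT => hcomm S (by simp [hS]) T (by simp [hT]))
      (fun S hS => hnil S (by simp [hS])) (U.map T) (by
        rintro S hS _ ⟨w, hw, rfl⟩
        refine ⟨S w, hU S (by simp [hS]) w hw, ?_⟩
        exact (LinearMap.congr_fun (hcomm T (by simp) S (by simp [hS])).eq w)) hdim
      (T u) ⟨u, hu, rfl⟩
    simpa using this

/-- A locally nilpotent operator preserving each member of a spanning family of subspaces of
bounded dimension is nilpotent. -/
lemma isNilpotent_of_locally_nilpotent {V ι : Type*} [AddCommGroup V] [Module ℂ V]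
    {U : ι → Submodule ℂ V} (hU : (⨆ l, U l) = ⊤) [∀ l, FiniteDimensional ℂ (U l)] {N : ℕ}
    (hN : ∀ l, finrank ℂ (U l) ≤ N) {S : End ℂ V} (hS : ∀ l, ∀ u ∈ U l, S u ∈ U l)
    (hloc : ∀ v, ∃ k : ℕ, (S ^ k) v = 0) : IsNilpotent S := by
  refine ⟨N, ?_⟩
  rw [← LinearMap.ker_eq_top, eq_top_iff, ← hU]
  refine iSup_le fun l u hu => ?_
  obtain ⟨k, hk⟩ := hloc u
  have hr : ∀ j, ((S.restrict (hS l)) ^ j) ⟨u, hu⟩ = 0 ↔ (S ^ j) u = 0 := by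
    intro j
    rw [Module.End.pow_restrict _ , ← Subtype.coe_inj]
    rfl
  have h1 := (Module.End.ker_pow_le_ker_pow_finrank (S.restrict (hS l)) k) ((hr k).2 hk)
  have h2 := (hr _).1 h1
  rw [LinearMap.mem_ker, ← Nat.sub_add_cancel (hN l), pow_add, Module.End.mul_apply, h2, map_zero]

end Nilpotency

/-- There is a complex linear form on `ℤⁿ` that vanishes only at `0`. -/
lemma exists_linear_form_ne_zero (n : ℕ) :
    ∃ c : Fin n → ℂ, ∀ m : Fin n → ℤ, m ≠ 0 → (∑ i, c i * (m i : ℂ)) ≠ 0 := by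
  have hrank : (n : Cardinal) ≤ Module.rank ℚ ℂ := by
    rw [Complex.rank_rat_complex]
    exact (Cardinal.natCast_le_aleph0).trans Cardinal.aleph0_le_continuum
  obtain ⟨s, hs, hli⟩ := le_rank_iff_exists_linearIndependent_finset.1 hrank
  let e : Fin n ≃ s := (Fintype.equivFinOfCardEq (by simpa using hs)).symm
  refine ⟨fun i => (e i : ℂ), fun m hm h => hm ?_⟩
  have hli' : LinearIndependent ℚ (fun i => (e i : ℂ)) := hli.comp e e.injective
  have := Fintype.linearIndependent_iff.1 hli' (fun i => (m i : ℚ)) (by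
    rw [← h]
    refine Finset.sum_congr rfl fun i _ => ?_
    rw [Rat.smul_def, mul_comm]
    norm_num)
  funext i
  exact_mod_cast this i

section EquivariantFamily

open Module

/-- Homogeneous elements of degree `m` with respect to the degree elements `d`. -/
def IsHomog {n : ℕ} {τ : Type*} [LieRing τ] [LieAlgebra ℂ τ] (d : Fin n → τ) (m : Fin n → ℤ)
    (X : τ) : Prop :=
  ∀ i, ⁅d i, X⁆ = (m i : ℂ) • X

lemma IsHomog.lie {n : ℕ} {τ : Type*} [LieRing τ] [LieAlgebra ℂ τ] {d : Fin n → τ}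
    {m k : Fin n → ℤ} {X Y : τ} (hX : IsHomog d m X) (hY : IsHomog d k Y) :
    IsHomog d (m + k) ⁅X, Y⁆ := by
  intro i
  rw [leibniz_lie, hX i, hY i, smul_lie, lie_smul, ← add_smul]
  push_cast [Pi.add_apply]
  rfl

lemma IsHomog.sum_smul {n : ℕ} {τ : Type*} [LieRing τ] [LieAlgebra ℂ τ] {d : Fin n → τ}
    {m : Fin n → ℤ} {X : τ} (hX : IsHomog d m X) (c : Fin n → ℂ) :
    ⁅∑ i, c i • d i, X⁆ = (∑ i, c i * (m i : ℂ)) • X := by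
  rw [sum_lie, Finset.sum_smul]
  exact Finset.sum_congr rfl fun i _ => by rw [smul_lie, hX i, smul_smul]

/-- Brackets of homogeneous elements of opposite nonzero degrees. -/
def oppositeBrackets {n : ℕ} {τ : Type*} [LieRing τ] [LieAlgebra ℂ τ] (d : Fin n → τ) : Set τ :=
  {Z | ∃ m X Y, m ≠ 0 ∧ IsHomog d m X ∧ IsHomog d (-m) Y ∧ Z = ⁅X, Y⁆}

/-- A linear map `F` from `τ` to operators on `V` with commuting image that intertwines the
adjoint action with the commutators with the operators `ρ Y`. -/
structure IsEquivariantFamily {τ V : Type*} [LieRing τ] [LieAlgebra ℂ τ] [AddCommGroup V]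
    [Module ℂ V] (F : τ →ₗ[ℂ] End ℂ V) (ρ : τ → End ℂ V) : Prop where
  comm : ∀ X Y, Commute (F X) (F Y)
  commutator : ∀ Y X, ρ Y * F X = F X * ρ Y + F ⁅Y, X⁆

variable {n : ℕ} {τ V : Type*} [LieRing τ] [LieAlgebra ℂ τ] [AddCommGroup V] [Module ℂ V]
  {F : τ →ₗ[ℂ] End ℂ V} {ρ : τ → End ℂ V} {d : Fin n → τ}

lemma IsEquivariantFamily.isNilpotent_of_oppositeBrackets [Nontrivial V]
    (hF : IsEquivariantFamily F ρ) {c : Fin n → ℂ}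
    (hc : ∀ m : Fin n → ℤ, m ≠ 0 → (∑ i, c i * (m i : ℂ)) ≠ 0)
    (hd : IsHomog d 0 (∑ i, c i • d i))
    (hspec : ∀ X, IsHomog d 0 X → ∃ μ : ℂ, IsNilpotent (F X - algebraMap ℂ _ μ)) :
    ∀ Z ∈ oppositeBrackets d, IsNilpotent (F Z) := by
  rintro _ ⟨m, X, Y, hm, hX, hY, rfl⟩
  have hY_nil : IsNilpotent (F Y) := by
    obtain ⟨μ, hμ⟩ := hspec _ hd
    have hcm := neg_ne_zero.2 (hc (-m) (neg_ne_zero.2 hm))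
    refine isNilpotent_of_commutator_smul (r := ρ Y) hcm ?_ ?_ ?_ hμ
    · rw [mul_sub, hF.commutator, ← lie_skew, hY.sum_smul, ← neg_smul, map_smul, sub_mul,
        Algebra.commutes μ (ρ Y)]
      abel
    · exact (hF.comm _ _).sub_left (Algebra.commutes μ (F Y))
    · have := hF.commutator Y Y
      rw [lie_self, map_zero, add_zero] at this
      exact this
  have h0 : IsHomog d 0 ⁅X, Y⁆ := by simpa using hX.lie hY
  obtain ⟨μ, hμ⟩ := hspec _ h0
  exact isNilpotent_commutator (hF.commutator X Y) (hF.comm _ _) hY_nil hμ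

/-- Homogeneous elements on which `F` is known to be nilpotent if the degree vanishes. -/
def goodElements (F : τ →ₗ[ℂ] End ℂ V) (d : Fin n → τ) : Set τ :=
  {X | ∃ m, IsHomog d m X ∧ (m = 0 → IsNilpotent (F X))}

theorem IsEquivariantFamily.prod_eq_zero {ι : Type*} [Nontrivial V]
    (hF : IsEquivariantFamily F ρ) {c : Fin n → ℂ}
    (hc : ∀ m : Fin n → ℤ, m ≠ 0 → (∑ i, c i * (m i : ℂ)) ≠ 0)
    (hd : IsHomog d 0 (∑ i, c i • d i)) (hd_nil : IsNilpotent (F (∑ i, c i • d i)))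
    (hbr : ∀ Z ∈ oppositeBrackets d, IsNilpotent (F Z))
    {U : ι → Submodule ℂ V} (hU : (⨆ l, U l) = ⊤) [∀ l, FiniteDimensional ℂ (U l)] {N : ℕ}
    (hN : ∀ l, finrank ℂ (U l) ≤ N)
    (hstab : ∀ X, IsHomog d 0 X → ∀ l, ∀ u ∈ U l, F X u ∈ U l) :
    ∀ (L s : ℕ) (R : List τ), R.length = L → N ≤ s + L → (∀ X ∈ R, X ∈ goodElements F d) →
      F (∑ i, c i • d i) ^ s * (R.map F).prod = 0 := by
  set Z := ∑ i, c i • d i with hZ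
  have hzero : ∀ (s : ℕ) (R : List τ), N ≤ s + R.length →
      (∀ X ∈ R, IsHomog d 0 X ∧ IsNilpotent (F X)) → F Z ^ s * (R.map F).prod = 0 := by
    intro s R hs hR
    have hall : ∀ S ∈ ((List.replicate s Z ++ R).map F).reverse,
        ∃ X, IsHomog d 0 X ∧ IsNilpotent (F X) ∧ F X = S := by
      intro S hS
      obtain ⟨X, hX, rfl⟩ := List.mem_map.1 (List.mem_reverse.1 hS)
      rcases List.mem_append.1 hX with h | h
      · rw [List.eq_of_mem_replicate h]
        exact ⟨Z, hd, hd_nil, rfl⟩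
      · exact ⟨X, (hR X h).1, (hR X h).2, rfl⟩
    rw [← LinearMap.ker_eq_top, eq_top_iff, ← hU]
    refine iSup_le fun l u hu => ?_
    have := prod_apply_eq_zero_of_finrank_le _
      (fun S hS T hT => by
        obtain ⟨X, -, -, rfl⟩ := hall S hS
        obtain ⟨X', -, -, rfl⟩ := hall T hT
        exact hF.comm _ _)
      (fun S hS => by
        obtain ⟨X, -, h, rfl⟩ := hall S hS
        exact h) (U l)
      (fun S hS => by
        obtain ⟨X, h, -, rfl⟩ := hall S hS
        exact hstab X h l) ((hN l).trans (by simpa [add_comm] using hs)) u hu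
    simpa using this
  intro L
  induction L with
  | zero =>
    intro s R hR hs _
    obtain rfl := List.length_eq_zero_iff.1 hR
    exact hzero s [] (by simpa using hs) (by simp)
  | succ L ih =>
    intro s R hR hs hgood
    by_cases hall : ∀ X ∈ R, IsHomog d 0 X ∧ IsNilpotent (F X)
    · exact hzero s R (by omega) hall
    push Not at hall
    obtain ⟨Y, hYR, hY⟩ := hall
    obtain ⟨m, hYm, hY0⟩ := hgood Y hYR
    have hm : m ≠ 0 := by
      rintro rfl
      exact hY hYm (hY0 rfl)
    obtain ⟨R₁, R₂, rfl⟩ := List.append_of_mem hYR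
    have hperm : (R₁ ++ Y :: R₂).Perm (Y :: (R₁ ++ R₂)) := List.perm_middle
    have hprod : ((R₁ ++ Y :: R₂).map F).prod = F Y * ((R₁ ++ R₂).map F).prod := by
      rw [(hperm.map F).prod_eq', List.map_cons, List.prod_cons]
      exact List.Pairwise.map F (fun X X' _ => hF.comm X X')
        (List.pairwise_of_forall (R := fun _ _ => True) fun _ _ => trivial)
    have hgood_lie : ∀ X ∈ goodElements F d, ⁅Y, X⁆ ∈ goodElements F d := by
      rintro X ⟨k, hk, -⟩
      refine ⟨m + k, hYm.lie hk, fun hmk => hbr _ ⟨m, Y, X, hm, hYm, ?_, rfl⟩⟩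
      rwa [← eq_neg_of_add_eq_zero_right hmk]
    have hmove : ∀ Q P : List τ, (P ++ Q).length = L → (∀ X ∈ P ++ Q, X ∈ goodElements F d) →
        F Z ^ (s + 1) * (P.map F).prod * (ρ Y * (Q.map F).prod) = 0 := by
      intro Q
      induction Q with
      | nil =>
        intro P hP hPg
        rw [ih (s + 1) P (by simpa using hP) (by omega) (by simpa using hPg), zero_mul]
      | cons X Q ihQ =>
        intro P hP hPg
        have h1 := ihQ (P ++ [X]) (by simpa using hP) (by simpa using hPg)
        have h2 := ih (s + 1) (P ++ ⁅Y, X⁆ :: Q) (by simpa using hP) (by omega) (by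
          intro W hW
          rcases List.mem_append.1 hW with h | h
          · exact hPg W (by simp [h])
          · rcases List.mem_cons.1 h with rfl | h
            · exact hgood_lie X (hPg X (by simp))
            · exact hPg W (by simp [h]))
        simp only [List.map_append, List.map_cons, List.map_nil, List.prod_append,
          List.prod_cons, List.prod_nil, mul_one] at h1 h2
        rw [List.map_cons, List.prod_cons, ← mul_assoc (ρ Y), hF.commutator, add_mul, mul_add]
        simp only [mul_assoc] at h1 h2 ⊢
        rw [h1, h2, add_zero]
    have hlen : (R₁ ++ R₂).length = L := by
      have := hperm.length_eq
      rw [hR, List.length_cons] at this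
      omega
    have hg' : ∀ X ∈ R₁ ++ R₂, X ∈ goodElements F d := fun X hX =>
      hgood X (hperm.mem_iff.2 (List.mem_cons_of_mem _ hX))
    have h1 := hmove (R₁ ++ R₂) [] hlen hg'
    have h2 : ρ Y * (F Z ^ (s + 1) * ((R₁ ++ R₂).map F).prod) = 0 := by
      rw [ih (s + 1) _ hlen (by omega) hg', mul_zero]
    have hlie : ⁅Y, Z⁆ = (-∑ i, c i * (m i : ℂ)) • Y := by
      rw [← lie_skew, hZ, hYm.sum_smul, neg_smul]
    rw [List.map_nil, List.prod_nil, mul_one, ← mul_assoc] at h1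
    rw [← mul_assoc, mul_pow_succ_of_mul_eq (hF.commutator Y Z) (hF.comm _ _), add_mul, h1,
      zero_add, ← map_natCast (algebraMap ℂ (End ℂ V)), ← Algebra.smul_def, smul_mul_assoc,
      smul_eq_zero_iff_right (Nat.cast_ne_zero.2 s.succ_ne_zero), hlie, map_smul, mul_smul_comm,
      smul_mul_assoc, smul_eq_zero_iff_right (neg_ne_zero.2 (hc m hm)), mul_assoc] at h2
    rw [hprod, h2]

/-- The range of an equivariant family is nilpotent as soon as `τ` is generated by the brackets
of opposite degrees together with elements of nonzero degree. -/
theorem IsEquivariantFamily.range_pow_eq_bot {ι : Type*} [Nontrivial V]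
    (hF : IsEquivariantFamily F ρ) (hd : ∀ i, IsHomog d 0 (d i))
    (hd_span : ∀ i, d i ∈ Submodule.span ℂ (oppositeBrackets d))
    (hspan : Submodule.span ℂ (oppositeBrackets d ∪ {X | ∃ m, m ≠ 0 ∧ IsHomog d m X}) = ⊤)
    (hspec : ∀ X, IsHomog d 0 X → ∃ μ : ℂ, IsNilpotent (F X - algebraMap ℂ _ μ))
    {U : ι → Submodule ℂ V} (hU : (⨆ l, U l) = ⊤) [∀ l, FiniteDimensional ℂ (U l)] {N : ℕ}
    (hN : ∀ l, finrank ℂ (U l) ≤ N)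
    (hstab : ∀ X, IsHomog d 0 X → ∀ l, ∀ u ∈ U l, F X u ∈ U l) :
    LinearMap.range F ^ N = ⊥ := by
  obtain ⟨c, hc⟩ := exists_linear_form_ne_zero n
  have hZ : IsHomog d 0 (∑ i, c i • d i) := by
    intro j
    rw [lie_sum]
    simp only [lie_smul, hd _ j]
    simp
  have hbr := hF.isNilpotent_of_oppositeBrackets hc hZ hspec
  have hZ_nil : IsNilpotent (F (∑ i, c i • d i)) :=
    isNilpotent_of_mem_span F hF.comm hbr
      (Submodule.sum_mem _ fun i _ => Submodule.smul_mem _ _ (hd_span i))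
  have hgood : Submodule.span ℂ (goodElements F d) = ⊤ := by
    rw [eq_top_iff, ← hspan]
    refine Submodule.span_mono ?_
    rintro Z (hZb | ⟨m, hm, hX⟩)
    · have hnil := hbr Z hZb
      obtain ⟨m, X, Y, -, hX, hY, rfl⟩ := hZb
      exact ⟨0, by simpa using hX.lie hY, fun _ => hnil⟩
    · exact ⟨m, hX, fun h => absurd h hm⟩
  have hrange : LinearMap.range F = Submodule.span ℂ (F '' goodElements F d) := by
    rw [LinearMap.range_eq_map, ← hgood, Submodule.map_span]
  rw [hrange, Submodule.span_pow, Submodule.span_eq_bot]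
  intro S hS
  obtain ⟨f, rfl⟩ := Set.mem_pow.1 hS
  choose g hg hgf using fun i => (f i).2
  have := hF.prod_eq_zero hc hZ hZ_nil hbr hU hN hstab N 0 (List.ofFn g) (by simp) (by simp)
    (by
      intro X hX
      obtain ⟨i, rfl⟩ := (List.mem_ofFn' _ _).1 hX
      exact hg i)
  rw [pow_zero, one_mul, List.map_ofFn] at this
  rw [← this]
  congr 2
  funext i
  exact (hgf i).symm

end EquivariantFamily

section FullToroidal

open Module

lemma isSimple_lie_span_eq_top (𝔤 : Type) [LieRing 𝔤] [LieAlgebra ℂ 𝔤]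
    [LieAlgebra.IsSimple ℂ 𝔤] :
    Submodule.span ℂ {z : 𝔤 | ∃ x y : 𝔤, ⁅x, y⁆ = z} = ⊤ := by
  have htop : (⁅(⊤ : LieIdeal ℂ 𝔤), (⊤ : LieIdeal ℂ 𝔤)⁆ : LieIdeal ℂ 𝔤) = ⊤ := by
    refine (LieAlgebra.IsSimple.eq_bot_or_eq_top (R := ℂ) _).resolve_left fun h => ?_
    refine LieAlgebra.IsSimple.non_abelian (R := ℂ) (L := 𝔤) ⟨fun x y => ?_⟩
    have : ⁅x, y⁆ ∈ (⁅(⊤ : LieIdeal ℂ 𝔤), (⊤ : LieIdeal ℂ 𝔤)⁆ : LieIdeal ℂ 𝔤) :=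
      LieSubmodule.lie_mem_lie (LieSubmodule.mem_top x) (LieSubmodule.mem_top y)
    rwa [h, LieSubmodule.mem_bot] at this
  have h := LieSubmodule.lieIdeal_oper_eq_linear_span' (R := ℂ) (L := 𝔤) (M := 𝔤)
    (I := (⊤ : LieIdeal ℂ 𝔤)) (N := (⊤ : LieIdeal ℂ 𝔤))
  rw [htop] at h
  simpa using h.symm

namespace IsFullToroidal

variable {n : ℕ} {𝔤 : Type} [LieRing 𝔤] [LieAlgebra ℂ 𝔤] {τ : Type} [LieRing τ] [LieAlgebra ℂ τ]
  {κ : 𝔤 →ₗ[ℂ] 𝔤 →ₗ[ℂ] ℂ} {c₁ c₂ : ℂ} {E : (Fin n → ℤ) → 𝔤 →ₗ[ℂ] τ}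
  {K W : (Fin n → ℤ) → Fin n → τ}

lemma isHomog_E (hτ : IsFullToroidal n 𝔤 τ κ c₁ c₂ E K W) (m : Fin n → ℤ) (x : 𝔤) :
    IsHomog (W 0) m (E m x) := fun i => by
  rw [hτ.lie_W_E, zero_add]

lemma isHomog_K (hτ : IsFullToroidal n 𝔤 τ κ c₁ c₂ E K W) (m : Fin n → ℤ) (j : Fin n) :
    IsHomog (W 0) m (K m j) := fun i => by
  rw [hτ.lie_W_K, zero_add]
  simp

lemma isHomog_W (hτ : IsFullToroidal n 𝔤 τ κ c₁ c₂ E K W) (m : Fin n → ℤ) (j : Fin n) :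
    IsHomog (W 0) m (W m j) := fun i => by
  rw [hτ.lie_W_W, zero_add]
  simp

lemma K_zero_mem_span (hn : 2 ≤ n) (hτ : IsFullToroidal n 𝔤 τ κ c₁ c₂ E K W) (j : Fin n) :
    K 0 j ∈ Submodule.span ℂ (oppositeBrackets (W 0)) := by
  have : Nontrivial (Fin n) := Fin.nontrivial_iff_two_le.2 hn
  obtain ⟨i, hij⟩ := exists_ne j
  have hm : (Pi.single i 1 : Fin n → ℤ) ≠ 0 := by simp
  have h := hτ.lie_W_K (Pi.single i 1) i (-Pi.single i 1) j
  rw [if_neg hij, add_neg_cancel] at h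
  have hK : K 0 j = -⁅W (Pi.single i 1) i, K (-Pi.single i 1) j⁆ := by
    rw [h]; simp
  rw [hK]
  exact Submodule.neg_mem _ (Submodule.subset_span
    ⟨_, _, _, hm, hτ.isHomog_W _ _, hτ.isHomog_K _ _, rfl⟩)

lemma W_zero_mem_span (hn : 2 ≤ n) (hτ : IsFullToroidal n 𝔤 τ κ c₁ c₂ E K W) (i : Fin n) :
    W 0 i ∈ Submodule.span ℂ (oppositeBrackets (W 0)) := by
  have hm : (Pi.single i 1 : Fin n → ℤ) ≠ 0 := by simp
  have h := hτ.lie_W_W (Pi.single i 1) i (-Pi.single i 1) i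
  rw [add_neg_cancel] at h
  set u : τ := ⁅W (Pi.single i 1) i, W (-Pi.single i 1) i⁆ with hu
  set y : τ := (c₁ * (-((((-Pi.single i 1 : Fin n → ℤ) i : ℤ) : ℂ) *
    (((Pi.single i 1 : Fin n → ℤ) i : ℤ) : ℂ))) +
      c₂ * ((((Pi.single i 1 : Fin n → ℤ) i : ℤ) : ℂ) *
        (((-Pi.single i 1 : Fin n → ℤ) i : ℤ) : ℂ))) •
      ∑ p, (((Pi.single i 1 : Fin n → ℤ) p : ℤ) : ℂ) • K 0 p with hy
  have hW : W 0 i = (-(1 / 2) : ℂ) • (u - y) := by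
    rw [h]
    simp only [Pi.neg_apply, Pi.single_eq_same]
    push_cast
    module
  rw [hW]
  refine Submodule.smul_mem _ _ (Submodule.sub_mem _ (Submodule.subset_span
    ⟨_, _, _, hm, hτ.isHomog_W _ _, hτ.isHomog_W _ _, rfl⟩) (Submodule.smul_mem _ _ ?_))
  exact Submodule.sum_mem _ fun p _ => Submodule.smul_mem _ _ (hτ.K_zero_mem_span hn p)

lemma E_zero_mem_span [LieAlgebra.IsSimple ℂ 𝔤] (hn : 2 ≤ n)
    (hτ : IsFullToroidal n 𝔤 τ κ c₁ c₂ E K W) (x : 𝔤) :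
    E 0 x ∈ Submodule.span ℂ (oppositeBrackets (W 0)) := by
  have hx : x ∈ Submodule.span ℂ {z : 𝔤 | ∃ x y : 𝔤, ⁅x, y⁆ = z} := by
    rw [isSimple_lie_span_eq_top]; trivial
  induction hx using Submodule.span_induction with
  | mem _ h =>
    obtain ⟨y, z, rfl⟩ := h
    let i : Fin n := ⟨0, by omega⟩
    have hm : (Pi.single i 1 : Fin n → ℤ) ≠ 0 := by simp
    have h := hτ.lie_E_E (Pi.single i 1) (-Pi.single i 1) y z
    rw [add_neg_cancel] at h
    rw [← sub_eq_iff_eq_add.2 h]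
    refine Submodule.sub_mem _ (Submodule.subset_span
      ⟨_, _, _, hm, hτ.isHomog_E _ _, hτ.isHomog_E _ _, rfl⟩) (Submodule.smul_mem _ _ ?_)
    exact Submodule.sum_mem _ fun p _ => Submodule.smul_mem _ _ (hτ.K_zero_mem_span hn p)
  | zero => rw [map_zero]; exact Submodule.zero_mem _
  | add x y _ _ hx hy => rw [map_add]; exact Submodule.add_mem _ hx hy
  | smul c x _ hx => rw [map_smul]; exact Submodule.smul_mem _ c hx

lemma span_oppositeBrackets_union [LieAlgebra.IsSimple ℂ 𝔤] (hn : 2 ≤ n)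
    (hτ : IsFullToroidal n 𝔤 τ κ c₁ c₂ E K W) :
    Submodule.span ℂ (oppositeBrackets (W 0) ∪ {X | ∃ m, m ≠ 0 ∧ IsHomog (W 0) m X}) = ⊤ := by
  rw [eq_top_iff, ← hτ.span_eq_top, Submodule.span_le]
  have hle : Submodule.span ℂ (oppositeBrackets (W 0)) ≤
      Submodule.span ℂ (oppositeBrackets (W 0) ∪ {X | ∃ m, m ≠ 0 ∧ IsHomog (W 0) m X}) :=
    Submodule.span_mono Set.subset_union_left
  have hne : ∀ {m X}, m ≠ 0 → IsHomog (W 0) m X →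
      X ∈ Submodule.span ℂ (oppositeBrackets (W 0) ∪ {X | ∃ m, m ≠ 0 ∧ IsHomog (W 0) m X}) :=
    fun hm hX => Submodule.subset_span (Or.inr ⟨_, hm, hX⟩)
  rintro _ ((⟨m, x, rfl⟩ | ⟨m, i, rfl⟩) | ⟨m, i, rfl⟩) <;> rcases eq_or_ne m 0 with rfl | hm
  · exact hle (hτ.E_zero_mem_span hn x)
  · exact hne hm (hτ.isHomog_E m x)
  · exact hle (hτ.K_zero_mem_span hn i)
  · exact hne hm (hτ.isHomog_K m i)
  · exact hle (hτ.W_zero_mem_span hn i)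
  · exact hne hm (hτ.isHomog_W m i)

end IsFullToroidal

/-- Modulo `I ^ 2`, a cofinite ideal of a Noetherian algebra has a finite spanning set. -/
lemma exists_finset_span_sup_sq {B : Type} [CommRing B] [Algebra ℂ B] [IsNoetherianRing B]
    (I : Ideal B) [FiniteDimensional ℂ (B ⧸ I)] :
    ∃ s : Finset B, (∀ a ∈ s, a ∈ I) ∧
      ∀ a ∈ I, ∃ b ∈ Submodule.span ℂ (s : Set B), a - b ∈ I ^ 2 := by
  classical
  have hfin : Module.Finite B I.Cotangent :=
    Module.Finite.of_surjective I.toCotangent I.toCotangent_surjective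
  have : IsScalarTower ℂ (B ⧸ I) I.Cotangent := ⟨fun c b x => by
    obtain ⟨b, rfl⟩ := Ideal.Quotient.mk_surjective b
    obtain ⟨x, rfl⟩ := I.toCotangent_surjective x
    change I.toCotangent ((c • b) • x) = c • I.toCotangent (b • x)
    rw [smul_assoc, ← algebraMap_smul B c (b • x), map_smul, algebraMap_smul]⟩
  have : Module.Finite (B ⧸ I) I.Cotangent := Module.Finite.of_restrictScalars_finite B _ _
  have : Module.Finite ℂ I.Cotangent := Module.Finite.trans (B ⧸ I) _
  obtain ⟨t, ht⟩ := Module.finite_def.1 this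
  choose g hg using I.toCotangent_surjective
  refine ⟨t.image fun x => (g x : B), ?_, ?_⟩
  · intro a ha
    obtain ⟨x, -, rfl⟩ := Finset.mem_image.1 ha
    exact (g x).2
  · intro a ha
    have key : ∀ y ∈ Submodule.span ℂ (t : Set I.Cotangent), ∃ b : I,
        (b : B) ∈ Submodule.span ℂ ((t.image fun x => (g x : B) : Finset B) : Set B) ∧
          I.toCotangent b = y := by
      intro y hy
      induction hy using Submodule.span_induction with
      | mem x hx =>
        exact ⟨g x, Submodule.subset_span (Finset.mem_coe.2 (Finset.mem_image_of_mem _ hx)), hg x⟩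
      | zero => exact ⟨0, Submodule.zero_mem _, map_zero _⟩
      | add x y _ _ hx hy =>
        obtain ⟨b, hb, rfl⟩ := hx
        obtain ⟨b', hb', rfl⟩ := hy
        exact ⟨b + b', Submodule.add_mem _ hb hb', map_add _ _ _⟩
      | smul c x _ hx =>
        obtain ⟨b, hb, rfl⟩ := hx
        exact ⟨c • b, Submodule.smul_mem _ c hb, by
          rw [← algebraMap_smul B c b, map_smul, algebraMap_smul]⟩
    obtain ⟨b, hb, hba⟩ := key (I.toCotangent ⟨a, ha⟩) (by rw [ht]; trivial)
    exact ⟨b, hb, I.toCotangent_eq.1 hba.symm⟩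

/-- If an operator commutes with its commutators with all elements of a Lie algebra acting
irreducibly and has an eigenvalue, then this is its only generalized eigenvalue. -/
lemma maxGenEigenspace_eq_top_of_isIrreducible {L V : Type*} [LieRing L] [LieAlgebra ℂ L]
    [AddCommGroup V] [Module ℂ V] [LieRingModule L V] [LieModule ℂ L V]
    (hirr : LieModule.IsIrreducible ℂ L V) {T : End ℂ V} {μ : ℂ} (hμ : T.HasEigenvalue μ)
    (hT : ∀ z : L, ∃ g, LieModule.toEnd ℂ L V z * T = T * LieModule.toEnd ℂ L V z + g ∧
      Commute T g) :
    T.maxGenEigenspace μ = ⊤ := by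
  let G : LieSubmodule ℂ L V :=
    { T.maxGenEigenspace μ with
      lie_mem := by
        intro z v hv
        obtain ⟨k, hk⟩ := (Module.End.mem_maxGenEigenspace _ _ _).1 hv
        obtain ⟨g, hg, hTg⟩ := hT z
        have hTg' : Commute (T - μ • 1) g := hTg.sub_left ((Commute.one_left g).smul_left μ)
        have h := LinearMap.congr_fun
          (mul_pow_succ_of_mul_eq (r := LieModule.toEnd ℂ L V z) (T := T - μ • 1) (g := g) (by
            rw [mul_sub, hg, sub_mul, mul_smul_comm, smul_mul_assoc, mul_one, one_mul]
            abel) hTg' k) v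
        refine (Module.End.mem_maxGenEigenspace _ _ _).2 ⟨k + 1, ?_⟩
        rw [(hTg'.pow_left k).eq] at h
        simp only [Module.End.mul_apply, LinearMap.add_apply, hk, map_zero, add_zero] at h
        rw [pow_succ', Module.End.mul_apply, hk, map_zero, map_zero] at h
        rw [← LieModule.toEnd_apply_apply ℂ, h, pow_succ', Module.End.mul_apply] }
  have hG : G ≠ ⊥ := by
    obtain ⟨v, hv⟩ := hμ.exists_hasEigenvector
    intro h
    have hvG : v ∈ G := by
      change v ∈ T.maxGenEigenspace μ
      exact (Module.End.mem_maxGenEigenspace _ _ _).2 ⟨1, by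
        have := hv.apply_eq_smul
        simp [this]⟩
    rw [h, LieSubmodule.mem_bot] at hvG
    exact hv.2 hvG
  have hGt : G = ⊤ := (IsSimpleOrder.eq_bot_or_eq_top G).resolve_left hG
  have : (G : Submodule ℂ V) = ⊤ := by rw [hGt]; rfl
  exact this

lemma actList_eq_prod {L V : Type*} [LieRing L] [LieAlgebra ℂ L]
    [AddCommGroup V] [Module ℂ V] [LieRingModule L V] [LieModule ℂ L V] (l : List L) (v : V) :
    actList l v = (l.map (LieModule.toEnd ℂ L V)).prod v := by
  induction l with
  | nil => rfl
  | cons x l ih => simp [actList, ih]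

end FullToroidal

section MapAlgebra

open Module

variable {B τ V : Type} [CommRing B] [Algebra ℂ B] [LieRing τ] [LieAlgebra ℂ τ]
  [AddCommGroup V] [Module ℂ V] [LieRingModule (B ⊗[ℂ] τ) V] [LieModule ℂ (B ⊗[ℂ] τ) V]

/-- The operators `a ⊗ X` on `V`, for fixed `a`, as a linear function of `X`. -/
noncomputable def tensorAction (V : Type) [AddCommGroup V] [Module ℂ V]
    [LieRingModule (B ⊗[ℂ] τ) V] [LieModule ℂ (B ⊗[ℂ] τ) V] (a : B) : τ →ₗ[ℂ] End ℂ V where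
  toFun X := LieModule.toEnd ℂ (B ⊗[ℂ] τ) V (a ⊗ₜ X)
  map_add' X Y := by rw [TensorProduct.tmul_add, map_add]
  map_smul' c X := by
    rw [TensorProduct.tmul_smul, RingHom.id_apply]
    exact map_smul (LieModule.toEnd ℂ (B ⊗[ℂ] τ) V) c _

lemma tensorAction_apply (a : B) (X : τ) (v : V) :
    tensorAction V a X v = ⁅a ⊗ₜ[ℂ] X, v⁆ := rfl

lemma tensorAction_mul (a b : B) (X Y : τ) :
    tensorAction V b Y * tensorAction V a X =
      tensorAction V a X * tensorAction V b Y + tensorAction V (b * a) ⁅Y, X⁆ := by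
  ext v
  simp only [Module.End.mul_apply, LinearMap.add_apply, tensorAction_apply]
  rw [leibniz_lie, LieAlgebra.ExtendScalars.bracket_tmul, add_comm]

lemma tensorAction_eq_zero {I : Ideal B} (hann : annTensor τ B I V) {a : B} (ha : a ∈ I)
    (X : τ) : tensorAction V a X = 0 :=
  LinearMap.ext fun v => hann X a ha v

lemma tensorAction_commute {I : Ideal B} (hann : annTensor τ B (I ^ 2) V) {a b : B} (ha : a ∈ I)
    (hb : b ∈ I) (X Y : τ) : Commute (tensorAction V a X) (tensorAction V b Y) := by
  have h := tensorAction_mul (V := V) b a Y X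
  have hab : a * b ∈ I ^ 2 := by rw [pow_two]; exact Ideal.mul_mem_mul ha hb
  rwa [tensorAction_eq_zero hann hab, add_zero] at h

lemma isEquivariantFamily_tensorAction {I : Ideal B} (hann : annTensor τ B (I ^ 2) V) {a : B}
    (ha : a ∈ I) : IsEquivariantFamily (tensorAction (τ := τ) V a) (tensorAction V (1 : B)) where
  comm X Y := tensorAction_commute hann ha ha X Y
  commutator Y X := by rw [tensorAction_mul, one_mul]

lemma tensorAction_mem_weightSpace {n : ℕ} {W : (Fin n → ℤ) → Fin n → τ} (a : B) {X : τ}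
    (hX : IsHomog (W 0) 0 X) (l : Fin n → ℂ) (u : V) (hu : u ∈ weightSpace (V := V) (dOp B W) l) :
    tensorAction V a X u ∈ weightSpace (V := V) (dOp B W) l := by
  intro i
  have h := LinearMap.congr_fun (tensorAction_mul (V := V) a 1 X (W 0 i)) u
  have hi : ⁅W 0 i, X⁆ = 0 := by simpa using hX i
  rw [hi, map_zero, add_zero] at h
  have hu' : tensorAction V (1 : B) (W 0 i) u = l i • u := hu i
  rw [Module.End.mul_apply, Module.End.mul_apply, hu', map_smul] at h
  exact h

lemma exists_isNilpotent_sub_algebraMap {n : ℕ} {W : (Fin n → ℤ) → Fin n → τ}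
    (hirr : LieModule.IsIrreducible ℂ (B ⊗[ℂ] τ) V) [Nontrivial V]
    (hsup : (⨆ l : Fin n → ℂ, weightSpace (V := V) (dOp B W) l) = ⊤)
    [hfd : ∀ l : Fin n → ℂ, FiniteDimensional ℂ (weightSpace (V := V) (dOp B W) l)] {N : ℕ}
    (hN : ∀ l : Fin n → ℂ, finrank ℂ (weightSpace (V := V) (dOp B W) l) ≤ N)
    {I : Ideal B} (hann : annTensor τ B (I ^ 2) V) {a : B} (ha : a ∈ I) {X : τ}
    (hX : IsHomog (W 0) 0 X) :
    ∃ μ : ℂ, IsNilpotent (tensorAction V a X - algebraMap ℂ _ μ) := by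
  have hstab := tensorAction_mem_weightSpace (V := V) a hX
  obtain ⟨l, hl⟩ : ∃ l, weightSpace (V := V) (dOp B W) l ≠ ⊥ := by
    by_contra! h
    simp only [h, iSup_bot] at hsup
    exact bot_ne_top hsup
  have : Nontrivial (weightSpace (V := V) (dOp B W) l) := Submodule.nontrivial_iff_ne_bot.2 hl
  obtain ⟨μ, hμ⟩ := Module.End.exists_eigenvalue ((tensorAction V a X).restrict (hstab l))
  have hev : (tensorAction V a X).HasEigenvalue μ := by
    obtain ⟨w, hw⟩ := hμ.exists_hasEigenvector
    refine Module.End.hasEigenvalue_of_hasEigenvector (x := (w : V))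
      ⟨Module.End.mem_eigenspace_iff.2 ?_, fun h => hw.2 (Subtype.ext h)⟩
    exact congrArg Subtype.val hw.apply_eq_smul
  have htop := maxGenEigenspace_eq_top_of_isIrreducible hirr hev (fun z => by
    induction z using TensorProduct.induction_on with
    | zero => exact ⟨0, by simp⟩
    | tmul b Y =>
      exact ⟨_, tensorAction_mul (V := V) a b X Y,
        tensorAction_commute hann ha (I.mul_mem_left b ha) _ _⟩
    | add x y hx hy =>
      obtain ⟨g, hg, hgc⟩ := hx
      obtain ⟨g', hg', hgc'⟩ := hy
      refine ⟨g + g', ?_, hgc.add_right hgc'⟩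
      rw [map_add, add_mul, hg, hg', mul_add]
      abel)
  refine ⟨μ, isNilpotent_of_locally_nilpotent hsup hN (fun l u hu => ?_) fun v => ?_⟩
  · exact Submodule.sub_mem _ (hstab l u hu) (Submodule.smul_mem _ μ hu)
  · have hv : v ∈ (tensorAction V a X).maxGenEigenspace μ := by rw [htop]; trivial
    obtain ⟨k, hk⟩ := (Module.End.mem_maxGenEigenspace _ _ _).1 hv
    exact ⟨k, by rwa [Algebra.algebraMap_eq_smul_one]⟩

end MapAlgebra

theorem statement_14
    (n : ℕ) (hn : 3 ≤ n)
    (𝔤 : Type) [LieRing 𝔤] [LieAlgebra ℂ 𝔤] [LieAlgebra.IsSimple ℂ 𝔤]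
    [FiniteDimensional ℂ 𝔤]
    (τ : Type) [LieRing τ] [LieAlgebra ℂ τ]
    (κ : 𝔤 →ₗ[ℂ] 𝔤 →ₗ[ℂ] ℂ) (c₁ c₂ : ℂ)
    (E : (Fin n → ℤ) → 𝔤 →ₗ[ℂ] τ) (K W : (Fin n → ℤ) → Fin n → τ)
    (hτ : IsFullToroidal n 𝔤 τ κ c₁ c₂ E K W)
    (B : Type) [CommRing B] [Algebra ℂ B] [Nontrivial B]
    (hB : Algebra.FiniteType ℂ B)
    (V : Type) [AddCommGroup V] [Module ℂ V]
    [LieRingModule (B ⊗[ℂ] τ) V] [LieModule ℂ (B ⊗[ℂ] τ) V]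
    (hirr : LieModule.IsIrreducible ℂ (B ⊗[ℂ] τ) V)
    (hcusp : IsCuspidal (V := V) (dOp B W))
    (𝔐 : Ideal B) (hcf : FiniteDimensional ℂ (B ⧸ 𝔐))
    (hann : annTensor τ B (𝔐 ^ 2) V) :
    ∃ P : ℕ, ∀ (Xs : Fin P → τ) (as : Fin P → B), (∀ j, as j ∈ 𝔐) → ∀ v : V,
      actList (List.ofFn fun j => as j ⊗ₜ[ℂ] Xs j) v = 0 := by
  obtain ⟨⟨hsup, hfd⟩, N, hN⟩ := hcusp
  have : Nontrivial V := (LieSubmodule.nontrivial_iff ℂ (B ⊗[ℂ] τ) V).1 hirr.toNontrivial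
  have hn2 : 2 ≤ n := by omega
  have : IsNoetherianRing B := Algebra.FiniteType.isNoetherianRing ℂ B
  have hpow : ∀ a ∈ 𝔐, LinearMap.range (tensorAction (τ := τ) V a) ^ N = ⊥ := fun a ha =>
    (isEquivariantFamily_tensorAction hann ha).range_pow_eq_bot (hτ.isHomog_W 0)
      (hτ.W_zero_mem_span hn2) (hτ.span_oppositeBrackets_union hn2)
      (fun _ hX => exists_isNilpotent_sub_algebraMap hirr hsup hN hann ha hX) hsup hN
      (fun _ hX l u hu => tensorAction_mem_weightSpace a hX l u hu)
  obtain ⟨s, hs, hspan⟩ := exists_finset_span_sup_sq 𝔐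
  obtain ⟨P, hP⟩ : IsNilpotent (∑ a ∈ s, LinearMap.range (tensorAction (τ := τ) V a)) := by
    refine Commute.isNilpotent_sum (R := Submodule ℂ (Module.End ℂ V))
      (fun a ha => ⟨N, hpow a (hs a ha)⟩) fun a b ha hb => ?_
    have hle : ∀ {a b : B}, a ∈ 𝔐 → b ∈ 𝔐 →
        LinearMap.range (tensorAction (τ := τ) V a) * LinearMap.range (tensorAction (τ := τ) V b) ≤
        LinearMap.range (tensorAction (τ := τ) V b) *
          LinearMap.range (tensorAction (τ := τ) V a) := by
      intro a b ha hb
      refine Submodule.mul_le.2 ?_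
      rintro _ ⟨X, rfl⟩ _ ⟨Y, rfl⟩
      rw [(tensorAction_commute hann ha hb X Y).eq]
      exact Submodule.mul_mem_mul ⟨Y, rfl⟩ ⟨X, rfl⟩
    exact le_antisymm (hle (hs a ha) (hs b hb)) (hle (hs b hb) (hs a ha))
  have hmem : ∀ (X : τ), ∀ a ∈ 𝔐, tensorAction V a X ∈
      ∑ a ∈ s, LinearMap.range (tensorAction (τ := τ) V a) := by
    intro X a ha
    obtain ⟨b, hb, hab⟩ := hspan a ha
    have hsplit : ∀ x y : B, tensorAction V (x + y) X =
        tensorAction V x X + tensorAction V y X := fun x y => LinearMap.ext fun v => by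
      simp only [LinearMap.add_apply, tensorAction_apply, TensorProduct.add_tmul, add_lie]
    rw [← sub_add_cancel a b, hsplit, tensorAction_eq_zero hann hab, zero_add]
    clear hab
    induction hb using Submodule.span_induction with
    | mem a ha =>
      classical
      rw [← Finset.add_sum_erase s _ (Finset.mem_coe.1 ha), Submodule.add_eq_sup]
      exact Submodule.mem_sup_left ⟨X, rfl⟩
    | zero =>
      rw [tensorAction_eq_zero hann (Ideal.zero_mem _)]
      exact Submodule.zero_mem _
    | add x y _ _ hx hy => rw [hsplit]; exact Submodule.add_mem _ hx hy
    | smul c x _ hx =>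
      have : tensorAction V (c • x) X = c • tensorAction V x X := LinearMap.ext fun v => by
        rw [LinearMap.smul_apply, tensorAction_apply, tensorAction_apply, ← smul_lie]
        rfl
      rw [this]
      exact Submodule.smul_mem _ c hx
  refine ⟨P, fun Xs as has v => ?_⟩
  have hprod : (List.ofFn fun j => tensorAction V (as j) (Xs j)).prod ∈
      (∑ a ∈ s, LinearMap.range (tensorAction (τ := τ) V a)) ^ P :=
    Submodule.pow_subset_pow _ (Set.mem_pow.2 ⟨fun j => ⟨_, hmem (Xs j) (as j) (has j)⟩, rfl⟩)
  rw [hP] at hprod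
  rw [actList_eq_prod, List.map_ofFn]
  exact LinearMap.congr_fun hprod v

end MT
end

section
/- Let M ≤ ℤ^n, β ∈ ℤ^n with ℤ^n = M ⊕ ℤβ, let X be an irreducible τ(B)_M-module on which (Y⊗b)·u = ψ(b)(Y⊗1)·u for an algebra homomorphism ψ : B → ℂ and all Y ∈ τ_M, b ∈ B, u ∈ X, and regard X as the highest weight space of the irreducible highest weight module 𝕃_{τ(B)}(X, β, M). Then for every j ∈ ℤ (positive, zero, and negative), every p ∈ ℂ^n, m ∈ M, b ∈ B, x ∈ g, and v ∈ X one has D(p, jβ+m)⊗(b−ψ(b)1)·v = 0, K(p, jβ+m)⊗(b−ψ(b)1)·v = 0, and (x⊗t^{jβ+m})⊗(b−ψ(b)1)·v = 0; i.e. every element of τ acts on X through the evaluation ψ. -/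
open scoped TensorProduct

namespace MT

variable {n : ℕ} {𝔤 : Type} [LieRing 𝔤] [LieAlgebra ℂ 𝔤]
variable {τ : Type} [LieRing τ] [LieAlgebra ℂ τ]

section Schur

open Polynomial

/-- If no translate `f - c` of an endomorphism has a kernel or a cokernel, then the
vectors `(f - c)⁻¹ u`, for `c ∈ ℂ`, are linearly independent. -/
theorem linearIndependent_resolvent {X : Type*} [AddCommGroup X] [Module ℂ X]
    (f : Module.End ℂ X) (hf : ∀ c : ℂ, IsUnit (f - algebraMap ℂ (Module.End ℂ X) c))
    {u : X} (hu : u ≠ 0) (g : ℂ → X)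
    (hg : ∀ c, (f - algebraMap ℂ (Module.End ℂ X) c) (g c) = u) :
    LinearIndependent ℂ g := by
  classical
  have hinj : ∀ p : ℂ[X], p ≠ 0 → Function.Injective (aeval f p) := by
    intro p hp
    have h : IsUnit (aeval f p) := by
      rw [(IsAlgClosed.splits p).eq_prod_roots, map_mul, aeval_C]
      refine IsUnit.mul ?_ ?_
      · exact (IsUnit.mk0 _ (leadingCoeff_ne_zero.2 hp)).map _
      · by_contra hc
        obtain ⟨k, hk, -⟩ := spectrum.exists_mem_of_not_isUnit_aeval_prod hc
        rw [spectrum.mem_iff, ← neg_sub, IsUnit.neg_iff] at hk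
        exact hk (hf k)
    exact ((Module.End.isUnit_iff _).1 h).1
  refine linearIndependent_iff'.2 fun s m hm i hi ↦ ?_
  let p : ℂ[X] := ∑ j ∈ s, C (m j) * ∏ k ∈ s.erase j, (Polynomial.X - C k)
  have hp : aeval f p u = 0 := by
    have h1 : aeval f (∏ k ∈ s, (Polynomial.X - C k)) (∑ j ∈ s, m j • g j) = aeval f p u := by
      rw [map_sum, map_sum, LinearMap.sum_apply]
      refine Finset.sum_congr rfl fun j hj ↦ ?_
      rw [← s.prod_erase_mul _ hj, map_mul, map_smul, Module.End.mul_apply]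
      simp [hg, Module.algebraMap_end_apply]
    rw [← h1, hm, map_zero]
  have hp0 : p = 0 := by
    by_contra h
    exact hu (hinj p h (by rw [hp, map_zero]))
  have h2 := congrArg (eval i) hp0
  simp only [p, eval_finsetSum, eval_mul, eval_C, eval_prod, eval_sub, eval_X, eval_zero] at h2
  rw [Finset.sum_eq_single_of_mem i hi] at h2
  · refine (mul_eq_zero.1 h2).resolve_right (Finset.prod_ne_zero_iff.2 fun j hj ↦ ?_)
    exact sub_ne_zero.2 (Finset.ne_of_mem_erase hj).symm
  · intro j _ hj
    rw [Finset.prod_eq_zero (Finset.mem_erase.2 ⟨Ne.symm hj, hi⟩) (sub_self i), mul_zero]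

/-- Schur's lemma for a countable set of operators acting irreducibly. -/
theorem exists_eq_algebraMap_of_countable {X : Type*} [AddCommGroup X] [Module ℂ X]
    (S : Set (Module.End ℂ X)) (hS : S.Countable)
    (hirr : ∀ Y : Submodule ℂ X, (∀ s ∈ S, ∀ y ∈ Y, s y ∈ Y) → Y = ⊥ ∨ Y = ⊤)
    (f : Module.End ℂ X) (hf : ∀ s ∈ S, Commute f s) :
    ∃ c : ℂ, f = algebraMap ℂ (Module.End ℂ X) c := by
  by_contra! hne
  obtain ⟨u, hu⟩ : ∃ u : X, u ≠ 0 := by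
    by_contra! h
    exact hne 0 (LinearMap.ext fun x ↦ by rw [h x, map_zero, map_zero])
  have hcomm : ∀ c : ℂ, ∀ s ∈ S, ∀ x,
      (f - algebraMap ℂ (Module.End ℂ X) c) (s x) =
        s ((f - algebraMap ℂ (Module.End ℂ X) c) x) := fun c s hs x ↦
    LinearMap.congr_fun ((hf s hs).sub_left (Algebra.commutes c s)).eq x
  have hker : ∀ c : ℂ, LinearMap.ker (f - algebraMap ℂ (Module.End ℂ X) c) = ⊥ := by
    intro c
    refine (hirr _ fun s hs y hy ↦ ?_).resolve_right fun h ↦ ?_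
    · rw [LinearMap.mem_ker] at hy ⊢
      rw [hcomm c s hs, hy, map_zero]
    · exact hne c (sub_eq_zero.1 (LinearMap.ker_eq_top.1 h))
  have hrange : ∀ c : ℂ, LinearMap.range (f - algebraMap ℂ (Module.End ℂ X) c) = ⊤ := by
    intro c
    refine (hirr _ fun s hs y hy ↦ ?_).resolve_left fun h ↦ ?_
    · obtain ⟨x, rfl⟩ := hy
      exact ⟨s x, hcomm c s hs x⟩
    · exact hne c (sub_eq_zero.1 (LinearMap.range_eq_bot.1 h))
  have hunit : ∀ c : ℂ, IsUnit (f - algebraMap ℂ (Module.End ℂ X) c) := fun c ↦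
    (Module.End.isUnit_iff _).2
      ⟨LinearMap.ker_eq_bot.1 (hker c), LinearMap.range_eq_top.1 (hrange c)⟩
  choose g hg using fun c ↦ LinearMap.range_eq_top.1 (hrange c) u
  have hlin := linearIndependent_resolvent f hunit hu g hg
  have hrank : Module.rank ℂ X ≤ Cardinal.aleph0 := by
    let e : Algebra.adjoin ℂ S →ₗ[ℂ] X :=
      (LinearMap.applyₗ u).comp (Algebra.adjoin ℂ S).val.toLinearMap
    have he : LinearMap.range e = ⊤ := by
      refine (hirr _ fun s hs y hy ↦ ?_).resolve_left fun h ↦ ?_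
      · obtain ⟨x, rfl⟩ := hy
        exact ⟨⟨s, Algebra.subset_adjoin hs⟩ * x, rfl⟩
      · exact hu (LinearMap.congr_fun (LinearMap.range_eq_bot.1 h) 1)
    refine (LinearMap.rank_le_of_surjective e (LinearMap.range_eq_top.1 he)).trans ?_
    exact (Algebra.rank_adjoin_le S).trans (max_le hS.le_aleph0 le_rfl)
  have hcard := hlin.cardinal_lift_le_rank
  rw [Cardinal.mk_complex, Cardinal.lift_continuum] at hcard
  exact absurd (hcard.trans (Cardinal.lift_le_aleph0.2 hrank))
    (not_le.2 Cardinal.aleph0_lt_continuum)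

end Schur

section Graded

variable {L V : Type*} [LieRing L] [LieAlgebra ℂ L] [AddCommGroup V] [Module ℂ V]
  [LieRingModule L V] [LieModule ℂ L V]

/-- The vectors obtained by applying elements of negative degree to singular vectors
of `D`-eigenvalue `μ`. -/
inductive Descends (P : ℤ → Set L) (D : L) (μ : ℂ) : V → Prop
  | singular (x : V) (hx : ∀ k, 0 < k → ∀ y ∈ P k, ⁅y, x⁆ = 0) (hD : ⁅D, x⁆ = μ • x) :
      Descends P D μ x
  | lower (k : ℤ) (hk : k < 0) (y : L) (hy : y ∈ P k) (x : V) (hx : Descends P D μ x) :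
      Descends P D μ ⁅y, x⁆

variable {P : ℤ → Set L} {D : L} {μ : ℂ}

theorem Descends.exists_lie_eq (hD : ∀ k, ∀ y ∈ P k, ⁅D, y⁆ = (k : ℂ) • y) {x : V}
    (hx : Descends P D μ x) : ∃ i : ℕ, ⁅D, x⁆ = (μ - i) • x := by
  induction hx with
  | singular x _ hx => exact ⟨0, by simpa using hx⟩
  | lower k hk y hy x _ ih =>
    obtain ⟨i, hi⟩ := ih
    obtain ⟨l, rfl⟩ : ∃ l : ℕ, k = -l := ⟨k.natAbs, by omega⟩
    refine ⟨i + l, ?_⟩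
    rw [leibniz_lie, hD _ y hy, hi, smul_lie, lie_smul, ← add_smul]
    congr 1
    push_cast
    ring

theorem Descends.lie_mem_span (hP : ∀ j k, ∀ y ∈ P j, ∀ z ∈ P k, ⁅y, z⁆ ∈ P (j + k))
    (hD : ∀ k, ∀ y ∈ P k, ⁅D, y⁆ = (k : ℂ) • y) {x : V} (hx : Descends P D μ x) :
    ∀ k, ∀ z ∈ P k, ⁅z, x⁆ ∈ Submodule.span ℂ {v : V | Descends P D μ v} := by
  induction hx with
  | singular x hs hx =>
    intro k z hz
    rcases lt_trichotomy k 0 with hk | rfl | hk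
    · exact Submodule.subset_span (Descends.lower k hk z hz x (.singular x hs hx))
    · refine Submodule.subset_span (Descends.singular _ (fun k hk y hy ↦ ?_) ?_)
      · rw [leibniz_lie, hs k hk y hy, lie_zero, add_zero]
        exact hs _ (by simpa using hk) _ (hP k 0 y hy z hz)
      · rw [leibniz_lie, hD 0 z hz, hx, Int.cast_zero, zero_smul, zero_lie, zero_add, lie_smul]
    · rw [hs k hk z hz]
      exact zero_mem _
  | lower l hl y hy x _ ih =>
    intro k z hz
    rw [leibniz_lie]
    refine add_mem (ih _ _ (hP k l z hz y hy)) ?_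
    have hle : Submodule.span ℂ {v : V | Descends P D μ v} ≤
        (Submodule.span ℂ {v : V | Descends P D μ v}).comap (LieModule.toEnd ℂ L V y) :=
      Submodule.span_le.2 fun v hv ↦ Submodule.subset_span (Descends.lower l hl y hy v hv)
    exact hle (ih k z hz)

/-- In an irreducible module there are no singular vectors strictly below an eigenvector of
the degree operator. -/
theorem eq_zero_of_singular [LieModule.IsIrreducible ℂ L V]
    (hP : ∀ j k, ∀ y ∈ P j, ∀ z ∈ P k, ⁅y, z⁆ ∈ P (j + k))
    (htop : Submodule.span ℂ (⋃ k, P k) = ⊤)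
    (hD : ∀ k, ∀ y ∈ P k, ⁅D, y⁆ = (k : ℂ) • y) {lam : ℂ} {u w : V} (hu : u ≠ 0)
    (hDu : ⁅D, u⁆ = lam • u) {j : ℕ} (hj : 0 < j) (hDw : ⁅D, w⁆ = (lam - j) • w)
    (hw : ∀ k, 0 < k → ∀ y ∈ P k, ⁅y, w⁆ = 0) : w = 0 := by
  set N : Submodule ℂ V := Submodule.span ℂ {v : V | Descends P D (lam - j) v} with hN
  have hgen : ∀ y ∈ ⋃ k, P k, ∀ v ∈ N, ⁅y, v⁆ ∈ N := by
    intro y hy v hv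
    obtain ⟨k, hk⟩ := Set.mem_iUnion.1 hy
    have hle : N ≤ N.comap (LieModule.toEnd ℂ L V y) :=
      Submodule.span_le.2 fun v hv ↦ Descends.lie_mem_span hP hD hv k y hk
    exact hle hv
  have hlie : ∀ (y : L) {v : V}, v ∈ N → ⁅y, v⁆ ∈ N := by
    intro y v hv
    have hy : y ∈ Submodule.span ℂ (⋃ k, P k) := htop ▸ Submodule.mem_top
    induction hy using Submodule.span_induction with
    | mem y hy => exact hgen y hy v hv
    | zero => rw [zero_lie]; exact zero_mem _
    | add y z _ _ hy hz => rw [add_lie]; exact add_mem hy hz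
    | smul c y _ hy => rw [smul_lie]; exact N.smul_mem c hy
  have hwN : w ∈ N := Submodule.subset_span (Descends.singular w hw hDw)
  let N' : LieSubmodule ℂ L V := { N with lie_mem := hlie _ }
  by_contra hw0
  have hN' : N' = ⊤ := (eq_bot_or_eq_top N').resolve_left fun h ↦
    hw0 ((LieSubmodule.mem_bot w).1 (h ▸ (show w ∈ N' from hwN)))
  have huN : u ∈ N := show u ∈ N' from hN' ▸ LieSubmodule.mem_top u
  have hle : N ≤ ⨆ ν, ⨆ _ : ν ≠ lam, (LieModule.toEnd ℂ L V D).eigenspace ν := by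
    refine Submodule.span_le.2 fun v hv ↦ ?_
    obtain ⟨i, hi⟩ := Descends.exists_lie_eq hD hv
    have hne : lam - j - i ≠ lam := by
      intro h
      have h' : ((j + i : ℕ) : ℂ) = 0 := by
        push_cast
        linear_combination -h
      have := Nat.cast_eq_zero.1 h'
      omega
    exact Submodule.mem_iSup_of_mem _ (Submodule.mem_iSup_of_mem hne
      (Module.End.mem_eigenspace_iff.2 hi))
  exact hu (Submodule.disjoint_def.1 ((LieModule.toEnd ℂ L V D).eigenspaces_iSupIndep lam) u
    (Module.End.mem_eigenspace_iff.2 hDu) (hle huN))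

end Graded

section MapAlgebra

variable {τ : Type} [LieRing τ] [LieAlgebra ℂ τ] {B : Type} [CommRing B] [Algebra ℂ B]
  {V : Type} [AddCommGroup V] [Module ℂ V] [LieRingModule (B ⊗[ℂ] τ) V]
  [LieModule ℂ (B ⊗[ℂ] τ) V]

/-- The action of `a ⊗ Y` on a vector, as a linear map in `Y`. -/
noncomputable def tmulAct (a : B) (v : V) : τ →ₗ[ℂ] V where
  toFun Y := ⁅a ⊗ₜ[ℂ] Y, v⁆
  map_add' Y Z := by rw [TensorProduct.tmul_add, add_lie]
  map_smul' c Y := by rw [TensorProduct.tmul_smul, smul_lie, RingHom.id_apply]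

@[simp]
theorem tmulAct_apply (a : B) (v : V) (Y : τ) : tmulAct a v Y = ⁅a ⊗ₜ[ℂ] Y, v⁆ := rfl

theorem lie_tmul_tmul (a b : B) (Y Z : τ) :
    ⁅a ⊗ₜ[ℂ] Y, b ⊗ₜ[ℂ] Z⁆ = (a * b) ⊗ₜ[ℂ] ⁅Y, Z⁆ := rfl

/-- Let `τ` be graded by the eigenvalues of `d ∈ τ₀`, with `τ₀` of countable dimension.  If
`τ₀ ⊗ B` acts through `ψ` on the top component `X` of an irreducible highest weight module of
`τ ⊗ B`, then so does all of `τ ⊗ B`. -/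
theorem tmul_lie_eq_zero_of_graded [LieModule.IsIrreducible ℂ (B ⊗[ℂ] τ) V]
    (T : ℤ → Submodule ℂ τ) (hT : ∀ j k, ∀ y ∈ T j, ∀ z ∈ T k, ⁅y, z⁆ ∈ T (j + k))
    (htop : ⨆ k, T k = ⊤) {d : τ} (hd0 : d ∈ T 0) (hd : ∀ k, ∀ y ∈ T k, ⁅d, y⁆ = (k : ℂ) • y)
    {C : Set τ} (hC : C.Countable) (hCT : C ⊆ T 0) (hTC : T 0 ≤ Submodule.span ℂ C)
    (ψ : B →ₐ[ℂ] ℂ) {X : Submodule ℂ V} (hXne : X ≠ ⊥)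
    (hplus : ∀ k, 0 < k → ∀ y ∈ T k, ∀ a : B, ∀ v ∈ X, ⁅a ⊗ₜ[ℂ] y, v⁆ = 0)
    (hstab : ∀ y ∈ T 0, ∀ v ∈ X, ⁅(1 : B) ⊗ₜ[ℂ] y, v⁆ ∈ X)
    (hXirr : ∀ Y : Submodule ℂ V, Y ≤ X →
      (∀ y ∈ T 0, ∀ v ∈ Y, ⁅(1 : B) ⊗ₜ[ℂ] y, v⁆ ∈ Y) → Y = ⊥ ∨ Y = X)
    (hψ : ∀ y ∈ T 0, ∀ a : B, ∀ v ∈ X, ⁅a ⊗ₜ[ℂ] y, v⁆ = ψ a • ⁅(1 : B) ⊗ₜ[ℂ] y, v⁆)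
    (k : ℤ) {Y : τ} (hY : Y ∈ T k) {a : B} (ha : ψ a = 0) {v : V} (hv : v ∈ X) :
    ⁅a ⊗ₜ[ℂ] Y, v⁆ = 0 := by
  obtain ⟨lam, hlam⟩ : ∃ lam : ℂ, ∀ v ∈ X, ⁅(1 : B) ⊗ₜ[ℂ] d, v⁆ = lam • v := by
    let R : T 0 → Module.End ℂ X := fun y ↦
      (LieModule.toEnd ℂ (B ⊗[ℂ] τ) V ((1 : B) ⊗ₜ[ℂ] (y : τ))).restrict (hstab y y.2)
    suffices h : ∃ lam : ℂ, R ⟨d, hd0⟩ = algebraMap ℂ (Module.End ℂ X) lam by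
      obtain ⟨lam, hlam⟩ := h
      exact ⟨lam, fun v hv ↦ congrArg Subtype.val (LinearMap.congr_fun hlam ⟨v, hv⟩)⟩
    refine exists_eq_algebraMap_of_countable (Set.image R (Set.preimage (↑) C))
      ((hC.preimage Subtype.coe_injective).image R) ?_ (R ⟨d, hd0⟩) ?_
    · intro Y hY
      have hstabY : ∀ y ∈ T 0, ∀ v ∈ Y.map X.subtype, ⁅(1 : B) ⊗ₜ[ℂ] y, v⁆ ∈ Y.map X.subtype := by
        rintro y hy _ ⟨v, hv, rfl⟩
        have hle : Submodule.span ℂ C ≤ (Y.map X.subtype).comap (tmulAct (1 : B) (v : V)) :=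
          Submodule.span_le.2 fun c hc ↦
            ⟨R ⟨c, hCT hc⟩ v, hY _ ⟨⟨c, hCT hc⟩, hc, rfl⟩ v hv, rfl⟩
        exact hle (hTC hy)
      rcases hXirr _ (Submodule.map_subtype_le X Y) hstabY with h | h
      · refine .inl (Submodule.map_injective_of_injective X.injective_subtype ?_)
        rw [h, Submodule.map_bot]
      · refine .inr (Submodule.map_injective_of_injective X.injective_subtype ?_)
        rw [h, Submodule.map_subtype_top]
    · rintro _ ⟨y, -, rfl⟩
      refine LinearMap.ext fun v ↦ Subtype.ext ?_
      change ⁅(1 : B) ⊗ₜ[ℂ] d, ⁅(1 : B) ⊗ₜ[ℂ] (y : τ), (v : V)⁆⁆ =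
        ⁅(1 : B) ⊗ₜ[ℂ] (y : τ), ⁅(1 : B) ⊗ₜ[ℂ] d, (v : V)⁆⁆
      rw [leibniz_lie, lie_tmul_tmul, hd 0 y y.2, Int.cast_zero, zero_smul,
        TensorProduct.tmul_zero, zero_lie, zero_add]
  let P : ℤ → Set (B ⊗[ℂ] τ) := fun k ↦ {z | ∃ a : B, ∃ y ∈ T k, z = a ⊗ₜ[ℂ] y}
  have hP : ∀ j k, ∀ y ∈ P j, ∀ z ∈ P k, ⁅y, z⁆ ∈ P (j + k) := by
    rintro j k _ ⟨a, y, hy, rfl⟩ _ ⟨b, z, hz, rfl⟩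
    exact ⟨a * b, ⁅y, z⁆, hT j k y hy z hz, lie_tmul_tmul a b y z⟩
  have hPtop : Submodule.span ℂ (⋃ k, P k) = ⊤ := by
    refine eq_top_iff.2 ?_
    rw [← TensorProduct.span_tmul_eq_top, Submodule.span_le]
    rintro _ ⟨a, y, rfl⟩
    have hle : ⨆ k, T k ≤
        (Submodule.span ℂ (⋃ k, P k)).comap (TensorProduct.mk ℂ B τ a) :=
      iSup_le fun k y hy ↦ Submodule.subset_span (Set.mem_iUnion.2 ⟨k, a, y, hy, rfl⟩)
    exact hle (htop ▸ Submodule.mem_top)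
  have hD : ∀ k, ∀ z ∈ P k, ⁅(1 : B) ⊗ₜ[ℂ] d, z⁆ = (k : ℂ) • z := by
    rintro k _ ⟨a, y, hy, rfl⟩
    rw [lie_tmul_tmul, hd k y hy, one_mul, TensorProduct.tmul_smul]
  obtain ⟨u, huX, hu⟩ := X.ne_bot_iff.1 hXne
  have hneg : ∀ (j : ℕ) (Y : τ), Y ∈ T (-j) → ∀ (a : B), ψ a = 0 → ∀ v ∈ X,
      ⁅a ⊗ₜ[ℂ] Y, v⁆ = 0 := by
    intro j
    induction j using Nat.strong_induction_on with
    | _ j ih =>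
      intro Y hY a ha v hv
      rcases Nat.eq_zero_or_pos j with rfl | hj
      · rw [hψ Y (by simpa using hY) a v hv, ha, zero_smul]
      refine eq_zero_of_singular hP hPtop hD hu (hlam u huX) hj ?_ ?_
      · rw [leibniz_lie, hD _ _ ⟨a, Y, hY, rfl⟩, hlam v hv, smul_lie, lie_smul, ← add_smul]
        congr 1
        push_cast
        ring
      · rintro k hk _ ⟨c, z, hz, rfl⟩
        rw [leibniz_lie, hplus k hk z hz c v hv, lie_zero, add_zero, lie_tmul_tmul]
        have hca : ψ (c * a) = 0 := by rw [map_mul, ha, mul_zero]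
        have hzY := hT k (-j) z hz Y hY
        rcases lt_or_ge (0 : ℤ) (k + -j) with h | h
        · exact hplus _ h _ hzY _ v hv
        · refine ih (j - k).toNat (by omega) _ ?_ _ hca v hv
          rwa [show -(((j - k).toNat : ℕ) : ℤ) = k + -j by omega]
  rcases lt_or_ge 0 k with hk | hk
  · exact hplus k hk Y hY a v hv
  · exact hneg k.natAbs Y (by rwa [show -((k.natAbs : ℕ) : ℤ) = k by omega]) a ha v hv

end MapAlgebra

section Toroidal

variable {n : ℕ} {𝔤 : Type} [LieRing 𝔤] [LieAlgebra ℂ 𝔤]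
  {τ : Type} [LieRing τ] [LieAlgebra ℂ τ]
  {κ : 𝔤 →ₗ[ℂ] 𝔤 →ₗ[ℂ] ℂ} {c₁ c₂ : ℂ}
  {E : (Fin n → ℤ) → 𝔤 →ₗ[ℂ] τ} {K W : (Fin n → ℤ) → Fin n → τ}

theorem E_mem_gradedPiece (m : Fin n → ℤ) (x : 𝔤) : E m x ∈ gradedPiece E K W m :=
  Submodule.subset_span (.inl (.inl ⟨x, rfl⟩))

theorem K_mem_gradedPiece (m : Fin n → ℤ) (i : Fin n) : K m i ∈ gradedPiece E K W m :=
  Submodule.subset_span (.inl (.inr ⟨i, rfl⟩))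

theorem W_mem_gradedPiece (m : Fin n → ℤ) (i : Fin n) : W m i ∈ gradedPiece E K W m :=
  Submodule.subset_span (.inr ⟨i, rfl⟩)

theorem IsFullToroidal.lie_mem_gradedPiece (hτ : IsFullToroidal n 𝔤 τ κ c₁ c₂ E K W)
    {m k : Fin n → ℤ} {y z : τ} (hy : y ∈ genOfDeg E K W m) (hz : z ∈ genOfDeg E K W k) :
    ⁅y, z⁆ ∈ gradedPiece E K W (m + k) := by
  have hE := E_mem_gradedPiece (E := E) (K := K) (W := W)
  have hK := K_mem_gradedPiece (E := E) (K := K) (W := W)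
  have hW := W_mem_gradedPiece (E := E) (K := K) (W := W)
  have hKs : ∀ (c : Fin n → ℂ) (m : Fin n → ℤ), ∑ i, c i • K m i ∈ gradedPiece E K W m :=
    fun c m ↦ sum_mem fun i _ ↦ Submodule.smul_mem _ _ (hK m i)
  have hWE : ∀ m i k x, ⁅W m i, E k x⁆ ∈ gradedPiece E K W (m + k) := fun m i k x ↦ by
    rw [hτ.lie_W_E]
    exact Submodule.smul_mem _ _ (hE _ _)
  have hWK : ∀ m i k j, ⁅W m i, K k j⁆ ∈ gradedPiece E K W (m + k) := fun m i k j ↦ by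
    rw [hτ.lie_W_K]
    refine add_mem (Submodule.smul_mem _ _ (hK _ _)) ?_
    split_ifs
    · exact hKs _ _
    · exact zero_mem _
  rcases hy with (⟨x, rfl⟩ | ⟨i, rfl⟩) | ⟨i, rfl⟩ <;>
    rcases hz with (⟨x', rfl⟩ | ⟨j, rfl⟩) | ⟨j, rfl⟩
  · rw [hτ.lie_E_E]
    exact add_mem (hE _ _) (Submodule.smul_mem _ _ (hKs _ _))
  · rw [hτ.lie_E_K]
    exact zero_mem _
  · rw [← lie_skew, add_comm]
    exact neg_mem (hWE _ _ _ _)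
  · rw [← lie_skew, hτ.lie_E_K, neg_zero]
    exact zero_mem _
  · rw [hτ.lie_K_K]
    exact zero_mem _
  · rw [← lie_skew, add_comm]
    exact neg_mem (hWK _ _ _ _)
  · exact hWE _ _ _ _
  · exact hWK _ _ _ _
  · rw [hτ.lie_W_W]
    exact add_mem (sub_mem (Submodule.smul_mem _ _ (hW _ _)) (Submodule.smul_mem _ _ (hW _ _)))
      (Submodule.smul_mem _ _ (hKs _ _))

theorem IsFullToroidal.lie_W_zero (hτ : IsFullToroidal n 𝔤 τ κ c₁ c₂ E K W) (i : Fin n)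
    {m : Fin n → ℤ} {y : τ} (hy : y ∈ genOfDeg E K W m) : ⁅W 0 i, y⁆ = (m i : ℂ) • y := by
  rcases hy with (⟨x, rfl⟩ | ⟨j, rfl⟩) | ⟨j, rfl⟩
  · rw [hτ.lie_W_E, zero_add]
  · simp [hτ.lie_W_K]
  · simp [hτ.lie_W_W]

variable (E K W) in
/-- The `ℤ`-grading of `τ` induced by an additive degree function on `ℤⁿ`. -/
def coarsePiece (deg : (Fin n → ℤ) →+ ℤ) (k : ℤ) : Submodule ℂ τ :=
  Submodule.span ℂ {y | ∃ m, deg m = k ∧ y ∈ genOfDeg E K W m}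

variable {deg : (Fin n → ℤ) →+ ℤ}

theorem gradedPiece_le_coarsePiece (m : Fin n → ℤ) :
    gradedPiece E K W m ≤ coarsePiece E K W deg (deg m) :=
  Submodule.span_mono fun _ hy ↦ ⟨m, rfl, hy⟩

theorem IsFullToroidal.lie_mem_coarsePiece (hτ : IsFullToroidal n 𝔤 τ κ c₁ c₂ E K W) (j k : ℤ)
    (y : τ) (hy : y ∈ coarsePiece E K W deg j) (z : τ) (hz : z ∈ coarsePiece E K W deg k) :
    ⁅y, z⁆ ∈ coarsePiece E K W deg (j + k) := by
  induction hy, hz using Submodule.span_induction₂ with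
  | mem_mem y z hy hz =>
    obtain ⟨m, rfl, hy⟩ := hy
    obtain ⟨k, rfl, hz⟩ := hz
    rw [← map_add]
    exact gradedPiece_le_coarsePiece _ (hτ.lie_mem_gradedPiece hy hz)
  | zero_left => rw [zero_lie]; exact zero_mem _
  | zero_right => rw [lie_zero]; exact zero_mem _
  | add_left x y z _ _ _ hx hy => rw [add_lie]; exact add_mem hx hy
  | add_right x y z _ _ _ hx hy => rw [lie_add]; exact add_mem hx hy
  | smul_left c x y _ _ h => rw [smul_lie]; exact Submodule.smul_mem _ _ h
  | smul_right c x y _ _ h => rw [lie_smul]; exact Submodule.smul_mem _ _ h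

theorem IsFullToroidal.iSup_coarsePiece (hτ : IsFullToroidal n 𝔤 τ κ c₁ c₂ E K W) :
    ⨆ k, coarsePiece E K W deg k = ⊤ := by
  refine eq_top_iff.2 ?_
  rw [← hτ.span_eq_top, Submodule.span_le]
  have hle : ∀ m, gradedPiece E K W m ≤ ⨆ k, coarsePiece E K W deg k := fun m ↦
    (gradedPiece_le_coarsePiece m).trans (le_iSup (coarsePiece E K W deg) (deg m))
  rintro _ ((⟨m, x, rfl⟩ | ⟨m, i, rfl⟩) | ⟨m, i, rfl⟩)
  · exact hle m (E_mem_gradedPiece m x)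
  · exact hle m (K_mem_gradedPiece m i)
  · exact hle m (W_mem_gradedPiece m i)

/-- The element of degree zero whose adjoint action is multiplication by the degree. -/
theorem IsFullToroidal.exists_degree_operator (hτ : IsFullToroidal n 𝔤 τ κ c₁ c₂ E K W) :
    ∃ d ∈ coarsePiece E K W deg 0,
      ∀ k, ∀ y ∈ coarsePiece E K W deg k, ⁅d, y⁆ = (k : ℂ) • y := by
  refine ⟨∑ i, (deg (Pi.single i 1) : ℂ) • W 0 i,
    sum_mem fun i _ ↦ Submodule.smul_mem _ _ ?_, fun k y hy ↦ ?_⟩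
  · exact map_zero deg ▸ gradedPiece_le_coarsePiece (E := E) (K := K) 0 (W_mem_gradedPiece 0 i)
  · induction hy using Submodule.span_induction with
    | mem y hy =>
      obtain ⟨m, rfl, hy⟩ := hy
      have hm : deg m = ∑ i, m i * deg (Pi.single i 1) := by
        conv_lhs => rw [← Finset.univ_sum_single m, map_sum]
        refine Finset.sum_congr rfl fun i _ ↦ ?_
        rw [← smul_eq_mul, ← map_zsmul, ← Pi.single_smul, smul_eq_mul, mul_one]
      simp_rw [sum_lie, smul_lie, hτ.lie_W_zero _ hy, smul_smul, ← Finset.sum_smul, hm]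
      push_cast
      simp_rw [mul_comm]
    | zero => simp
    | add y z _ _ hy hz => rw [lie_add, hy, hz, smul_add]
    | smul c y _ hy => rw [lie_smul, hy, smul_comm]

theorem exists_countable_span_coarsePiece [FiniteDimensional ℂ 𝔤] (k : ℤ) :
    ∃ C : Set τ, C.Countable ∧ C ⊆ coarsePiece E K W deg k ∧
      coarsePiece E K W deg k ≤ Submodule.span ℂ C := by
  let b := Module.finBasis ℂ 𝔤
  let C : Set τ := ⋃ m : {m // deg m = k},
    Set.range (fun i ↦ E m (b i)) ∪ Set.range (K m) ∪ Set.range (W m)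
  have hC : ∀ m, deg m = k → Set.range (fun i ↦ E m (b i)) ∪ Set.range (K m) ∪ Set.range (W m) ⊆
      Submodule.span ℂ C := fun m hm ↦
    (Set.subset_iUnion (fun m : {m // deg m = k} ↦
      Set.range (fun i ↦ E m (b i)) ∪ Set.range (K m) ∪ Set.range (W m)) ⟨m, hm⟩).trans
      Submodule.subset_span
  refine ⟨C, ?_, ?_, ?_⟩
  · exact Set.countable_iUnion fun m ↦
      ((Set.countable_range _).union (Set.countable_range _)).union (Set.countable_range _)
  · refine Set.iUnion_subset fun ⟨m, hm⟩ ↦ ?_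
    subst hm
    rintro _ ((⟨i, rfl⟩ | ⟨i, rfl⟩) | ⟨i, rfl⟩)
    · exact gradedPiece_le_coarsePiece m (E_mem_gradedPiece m _)
    · exact gradedPiece_le_coarsePiece m (K_mem_gradedPiece m _)
    · exact gradedPiece_le_coarsePiece m (W_mem_gradedPiece m _)
  · refine Submodule.span_le.2 ?_
    rintro _ ⟨m, hm, (⟨x, rfl⟩ | ⟨i, rfl⟩) | ⟨i, rfl⟩⟩
    · rw [← b.sum_repr x, map_sum]
      refine sum_mem fun i _ ↦ ?_
      rw [map_smul]
      exact Submodule.smul_mem _ _ (hC m hm (.inl (.inl ⟨i, rfl⟩)))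
    · exact hC m hm (.inl (.inr ⟨i, rfl⟩))
    · exact hC m hm (.inr ⟨i, rfl⟩)

end Toroidal

/-- The projection along a complement of a nonzero cyclic subgroup of `ℤⁿ`. -/
theorem exists_degree_of_isCompl {n : ℕ} {M : AddSubgroup (Fin n → ℤ)} {β : Fin n → ℤ}
    (hβ : β ≠ 0) (h : IsCompl M (AddSubgroup.zmultiples β)) :
    ∃ deg : (Fin n → ℤ) →+ ℤ, deg β = 1 ∧ ∀ m, deg m = 0 ↔ m ∈ M := by
  have hex : ∀ m, ∃ j : ℤ, m - j • β ∈ M := fun m ↦ by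
    obtain ⟨a, ha, _, ⟨j, rfl⟩, hab⟩ :=
      AddSubgroup.mem_sup.1 (h.sup_eq_top ▸ AddSubgroup.mem_top m)
    exact ⟨j, by rw [← hab]; simpa using ha⟩
  have hzero : ∀ j : ℤ, j • β ∈ M → j = 0 := fun j hj ↦
    (smul_eq_zero.1 (AddSubgroup.disjoint_def.1 h.disjoint hj ⟨j, rfl⟩)).resolve_right hβ
  choose deg hdeg using hex
  have huniq : ∀ m (j : ℤ), m - j • β ∈ M → deg m = j := fun m j hj ↦
    (sub_eq_zero.1 (hzero (j - deg m) (by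
      convert M.sub_mem (hdeg m) hj using 1
      rw [sub_smul]
      abel))).symm
  refine ⟨AddMonoidHom.mk' deg fun a b ↦ huniq _ _ ?_, huniq _ _ ?_,
    fun m ↦ ⟨fun hm ↦ ?_, fun hm ↦ ?_⟩⟩
  · convert M.add_mem (hdeg a) (hdeg b) using 1
    rw [add_smul]
    abel
  · simp
  · have hm' : deg m = 0 := hm
    simpa [hm'] using hdeg m
  · exact huniq _ _ (by simpa using hm)

theorem statement_15
    (n : ℕ) (hn : 3 ≤ n)
    (𝔤 : Type) [LieRing 𝔤] [LieAlgebra ℂ 𝔤] [LieAlgebra.IsSimple ℂ 𝔤]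
    [FiniteDimensional ℂ 𝔤]
    (τ : Type) [LieRing τ] [LieAlgebra ℂ τ]
    (κ : 𝔤 →ₗ[ℂ] 𝔤 →ₗ[ℂ] ℂ) (c₁ c₂ : ℂ)
    (E : (Fin n → ℤ) → 𝔤 →ₗ[ℂ] τ) (K W : (Fin n → ℤ) → Fin n → τ)
    (hτ : IsFullToroidal n 𝔤 τ κ c₁ c₂ E K W)
    (B : Type) [CommRing B] [Algebra ℂ B] [Nontrivial B]
    (hB : Algebra.FiniteType ℂ B)
    (V : Type) [AddCommGroup V] [Module ℂ V]
    [LieRingModule (B ⊗[ℂ] τ) V] [LieModule ℂ (B ⊗[ℂ] τ) V]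
    (hirr : LieModule.IsIrreducible ℂ (B ⊗[ℂ] τ) V)
    (M : AddSubgroup (Fin n → ℤ)) (β : Fin n → ℤ)
    (hcompl : IsCompl M (AddSubgroup.zmultiples β))
    (ψ : B →ₐ[ℂ] ℂ) (X : Submodule ℂ V) (hXne : X ≠ ⊥)
    -- `X` is annihilated by `τ(B)^+_M`
    (hplus : ∀ v ∈ X, annPlus B E K W M β v)
    -- `X` is stable under `τ(B)_M`
    (hstab : ∀ Y ∈ tauMGens E K W M, ∀ a : B, ∀ u ∈ X, ⁅a ⊗ₜ[ℂ] Y, u⁆ ∈ X)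
    -- `X` is an irreducible `τ(B)_M`-module
    (hXirr : ∀ Y' : Submodule ℂ V, Y' ≤ X →
      (∀ Z ∈ tauMGens E K W M, ∀ a : B, ∀ u ∈ Y', ⁅a ⊗ₜ[ℂ] Z, u⁆ ∈ Y') →
      Y' = ⊥ ∨ Y' = X)
    -- `X` generates `V` (so `V` is the irreducible highest weight module `𝕃(X, β, M)`)
    (hgen : LieSubmodule.lieSpan ℂ (B ⊗[ℂ] τ) (X : Set V) = ⊤)
    -- `τ(B)_M` acts on `X` through the evaluation `ψ`
    (hψ : ∀ Y ∈ tauMGens E K W M, ∀ b : B, ∀ u ∈ X,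
      ⁅b ⊗ₜ[ℂ] Y, u⁆ = ψ b • ⁅(1 : B) ⊗ₜ[ℂ] Y, u⁆) :
    ∀ (j : ℤ), ∀ m₀ ∈ M, ∀ (p : Fin n → ℂ) (b : B) (x : 𝔤), ∀ v ∈ X,
      ⁅(b - algebraMap ℂ B (ψ b)) ⊗ₜ[ℂ] (∑ i, p i • W (j • β + m₀) i), v⁆ = 0 ∧
      ⁅(b - algebraMap ℂ B (ψ b)) ⊗ₜ[ℂ] (∑ i, p i • K (j • β + m₀) i), v⁆ = 0 ∧
      ⁅(b - algebraMap ℂ B (ψ b)) ⊗ₜ[ℂ] E (j • β + m₀) x, v⁆ = 0 := by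
  rcases eq_or_ne β 0 with rfl | hβ
  · have hM : ∀ m, m ∈ M := fun m ↦ by
      rw [AddSubgroup.zmultiples_zero_eq_bot] at hcompl
      rw [eq_top_of_isCompl_bot hcompl]
      exact AddSubgroup.mem_top m
    intro j m₀ _ p b x v hv
    have hzero : ∀ m, ∀ y ∈ gradedPiece E K W m,
        ⁅(b - algebraMap ℂ B (ψ b)) ⊗ₜ[ℂ] y, v⁆ = 0 := fun m y hy ↦ by
      have hle : gradedPiece E K W m ≤
          LinearMap.ker (tmulAct (b - algebraMap ℂ B (ψ b)) v : τ →ₗ[ℂ] V) :=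
        Submodule.span_le.2 fun y hy ↦ by
          rw [SetLike.mem_coe, LinearMap.mem_ker, tmulAct_apply, hψ y ⟨m, hM m, hy⟩ _ v hv]
          simp
      exact hle hy
    exact ⟨hzero _ _ (sum_mem fun i _ ↦ Submodule.smul_mem _ _ (W_mem_gradedPiece _ i)),
      hzero _ _ (sum_mem fun i _ ↦ Submodule.smul_mem _ _ (K_mem_gradedPiece _ i)),
      hzero _ _ (E_mem_gradedPiece _ x)⟩
  obtain ⟨deg, hdegβ, hdegM⟩ := exists_degree_of_isCompl hβ hcompl
  obtain ⟨d, hd0, hd⟩ := hτ.exists_degree_operator (deg := deg)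
  obtain ⟨C, hC, hCT, hTC⟩ := exists_countable_span_coarsePiece (E := E) (K := K) (W := W)
    (deg := deg) 0
  have hzero : ∀ y, y ∈ tauMGens E K W M ↔ ∃ m, deg m = 0 ∧ y ∈ genOfDeg E K W m := fun y ↦ by
    simp_rw [hdegM]
    rfl
  have hplus' : ∀ k, 0 < k → ∀ y ∈ coarsePiece E K W deg k, ∀ a : B, ∀ v ∈ X,
      ⁅a ⊗ₜ[ℂ] y, v⁆ = 0 := by
    intro k hk y hy a v hv
    have hle : coarsePiece E K W deg k ≤ LinearMap.ker (tmulAct a v : τ →ₗ[ℂ] V) := by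
      refine Submodule.span_le.2 ?_
      rintro z ⟨m, rfl, hz⟩
      obtain ⟨h₁, h₂, h₃⟩ := hplus v hv (m - deg m • β)
        ((hdegM _).1 (by rw [map_sub, map_zsmul, hdegβ]; simp)) (deg m).toNat (by omega) a
      rw [Int.toNat_of_nonneg hk.le, sub_add_cancel] at h₁ h₂ h₃
      rcases hz with (⟨x, rfl⟩ | ⟨i, rfl⟩) | ⟨i, rfl⟩
      · exact h₁ x
      · exact h₂ i
      · exact h₃ i
    exact hle hy
  have hstab' : ∀ Y : Submodule ℂ V,
      (∀ y ∈ tauMGens E K W M, ∀ v ∈ Y, ⁅(1 : B) ⊗ₜ[ℂ] y, v⁆ ∈ Y) →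
      ∀ y ∈ coarsePiece E K W deg 0, ∀ v ∈ Y, ⁅(1 : B) ⊗ₜ[ℂ] y, v⁆ ∈ Y := by
    intro Y hY y hy v hv
    have hle : coarsePiece E K W deg 0 ≤ Y.comap (tmulAct (1 : B) v) :=
      Submodule.span_le.2 fun y hy ↦ hY y ((hzero y).2 hy) v hv
    exact hle hy
  have hψ' : ∀ y ∈ coarsePiece E K W deg 0, ∀ a : B, ∀ v ∈ X,
      ⁅a ⊗ₜ[ℂ] y, v⁆ = ψ a • ⁅(1 : B) ⊗ₜ[ℂ] y, v⁆ := by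
    intro y hy a v hv
    have hle : coarsePiece E K W deg 0 ≤
        LinearMap.eqLocus (tmulAct a v) (ψ a • tmulAct (1 : B) v) :=
      Submodule.span_le.2 fun y hy ↦ hψ y ((hzero y).2 hy) a v hv
    exact hle hy
  intro j m₀ hm₀ p b x v hv
  have hdeg : deg (j • β + m₀) = j := by
    rw [map_add, map_zsmul, hdegβ, (hdegM _).2 hm₀]
    simp
  have hb : ψ (b - algebraMap ℂ B (ψ b)) = 0 := by simp
  have hmain : ∀ y ∈ gradedPiece E K W (j • β + m₀),
      ⁅(b - algebraMap ℂ B (ψ b)) ⊗ₜ[ℂ] y, v⁆ = 0 := fun y hy ↦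
    tmul_lie_eq_zero_of_graded (coarsePiece E K W deg) hτ.lie_mem_coarsePiece
      hτ.iSup_coarsePiece hd0 hd hC hCT hTC ψ hXne hplus'
      (hstab' X fun y hy v hv ↦ hstab y hy 1 v hv)
      (fun Y hYX hY ↦ hXirr Y hYX fun y hy a v hv ↦ by
        rw [hψ y hy a v (hYX hv)]
        exact Y.smul_mem _ (hY y (Submodule.subset_span ((hzero y).1 hy)) v hv))
      hψ' j (hdeg ▸ gradedPiece_le_coarsePiece _ hy) hb hv
  exact ⟨hmain _ (sum_mem fun i _ ↦ Submodule.smul_mem _ _ (W_mem_gradedPiece _ i)),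
    hmain _ (sum_mem fun i _ ↦ Submodule.smul_mem _ _ (K_mem_gradedPiece _ i)),
    hmain _ (E_mem_gradedPiece _ x)⟩

end MT
end

section
/- Let M be a subgroup of ℤ^n with ℤ^n = ℤα_1 ⊕ M, let {α_2,…,α_n} be a ℤ-basis of M, and let {β_1,…,β_n} ⊂ ℝ^n be the dual basis, (β_i | α_j) = δ_{ij}. Let τ̊ be the Lie subalgebra of τ spanned by { x⊗t^{m̄}, t^{m̄}K_i, t^{m̄}d_i : m̄ ∈ {0}×ℤ^{n−1}, x ∈ g, 1 ≤ i ≤ n }. Then the linear map Φ : τ̊ → τ_M defined on m̄ = (0, m_2, …, m_n) with m' = Σ_{i=2}^n m_i α_i by Φ(x⊗t^{m̄}) = x⊗t^{m'}, Φ(t^{m̄}K_i) = K(α_i, m'), Φ(t^{m̄}d_i) = D(β_i, m'), is a Lie algebra isomorphism onto τ_M = ⊕_{m∈M} τ_m. -/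
open scoped TensorProduct

namespace MT

variable {n : ℕ} {𝔤 : Type} [LieRing 𝔤] [LieAlgebra ℂ 𝔤]
variable {τ : Type} [LieRing τ] [LieAlgebra ℂ τ]

/-- The element `D(p,m)` (or `K(p,m)`) attached to a family `X` of generators. -/
noncomputable abbrev comb {n : ℕ} {τ : Type} [LieRing τ] [LieAlgebra ℂ τ] (X : Fin n → τ) :
    (Fin n → ℂ) →ₗ[ℂ] τ :=
  Fintype.linearCombination ℂ X

/-- The complex vector with the coordinates of an integer vector. -/
abbrev toComplex {n : ℕ} (m : Fin n → ℤ) : Fin n → ℂ := fun i => (m i : ℂ)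

theorem vec_induction {n : ℕ} {P : (Fin n → ℂ) → Prop} (single : ∀ i, P (Pi.single i 1))
    (zero : P 0) (add : ∀ p q, P p → P q → P (p + q)) (smul : ∀ (a : ℂ) p, P p → P (a • p))
    (p : Fin n → ℂ) : P p := by
  have hp : p ∈ Submodule.span ℂ (Set.range (Pi.basisFun ℂ (Fin n))) := by
    rw [Module.Basis.span_eq]; trivial
  induction hp using Submodule.span_induction with
  | mem x h => obtain ⟨i, rfl⟩ := h; simpa using single i
  | zero => exact zero
  | add x y _ _ hx hy => exact add x y hx hy
  | smul a x _ hx => exact smul a x hx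

namespace IsFullToroidal

variable {κ : 𝔤 →ₗ[ℂ] 𝔤 →ₗ[ℂ] ℂ} {c₁ c₂ : ℂ}
  {E : (Fin n → ℤ) → 𝔤 →ₗ[ℂ] τ} {K W : (Fin n → ℤ) → Fin n → τ}

theorem comb_K_self (hτ : IsFullToroidal n 𝔤 τ κ c₁ c₂ E K W) (m : Fin n → ℤ) :
    comb (K m) (toComplex m) = 0 :=
  hτ.K_rel m

theorem lie_comb_W_E (hτ : IsFullToroidal n 𝔤 τ κ c₁ c₂ E K W) (m k : Fin n → ℤ)
    (p : Fin n → ℂ) (x : 𝔤) :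
    ⁅comb (W m) p, E k x⁆ = (p ⬝ᵥ toComplex k) • E (m + k) x := by
  induction p using vec_induction with
  | single i => simp [Fintype.linearCombination_apply_single, hτ.lie_W_E]
  | zero => simp
  | add p q hp hq => simp only [map_add, add_lie, hp, hq, add_dotProduct, add_smul]
  | smul a p hp => simp only [map_smul, smul_lie, hp, smul_dotProduct, smul_assoc]

theorem lie_E_comb_K (hτ : IsFullToroidal n 𝔤 τ κ c₁ c₂ E K W) (m k : Fin n → ℤ)
    (x : 𝔤) (q : Fin n → ℂ) : ⁅E m x, comb (K k) q⁆ = 0 := by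
  simp [Fintype.linearCombination_apply, lie_sum, hτ.lie_E_K]

theorem lie_comb_K_comb_K (hτ : IsFullToroidal n 𝔤 τ κ c₁ c₂ E K W) (m k : Fin n → ℤ)
    (p q : Fin n → ℂ) : ⁅comb (K m) p, comb (K k) q⁆ = 0 := by
  simp [Fintype.linearCombination_apply, lie_sum, sum_lie, hτ.lie_K_K]

theorem lie_comb_W_comb_K (hτ : IsFullToroidal n 𝔤 τ κ c₁ c₂ E K W) (m k : Fin n → ℤ)
    (p q : Fin n → ℂ) :
    ⁅comb (W m) p, comb (K k) q⁆ = (p ⬝ᵥ toComplex k) • comb (K (m + k)) q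
      + (p ⬝ᵥ q) • comb (K (m + k)) (toComplex m) := by
  induction p using vec_induction with
  | zero => simp
  | add p p' hp hp' => simp only [map_add, add_lie, hp, hp', add_dotProduct]; module
  | smul a p hp => simp only [map_smul, smul_lie, hp, smul_dotProduct, smul_eq_mul]; module
  | single i =>
    induction q using vec_induction with
    | zero => simp
    | add q q' hq hq' => simp only [map_add, lie_add, hq, hq', dotProduct_add]; module
    | smul a q hq => simp only [map_smul, lie_smul, hq, dotProduct_smul, smul_eq_mul]; module
    | single j =>
      rw [Fintype.linearCombination_apply_single, Fintype.linearCombination_apply_single,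
        Fintype.linearCombination_apply_single, one_smul, one_smul, one_smul, hτ.lie_W_K,
        single_dotProduct, single_dotProduct, one_mul, one_mul, Pi.single_apply, ite_smul,
        one_smul, zero_smul, Fintype.linearCombination_apply]

theorem lie_comb_W_comb_W (hτ : IsFullToroidal n 𝔤 τ κ c₁ c₂ E K W) (m k : Fin n → ℤ)
    (p q : Fin n → ℂ) :
    ⁅comb (W m) p, comb (W k) q⁆ = (p ⬝ᵥ toComplex k) • comb (W (m + k)) q
      - (q ⬝ᵥ toComplex m) • comb (W (m + k)) p
      + (c₁ * (-((p ⬝ᵥ toComplex k) * (q ⬝ᵥ toComplex m)))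
          + c₂ * ((p ⬝ᵥ toComplex m) * (q ⬝ᵥ toComplex k)))
        • comb (K (m + k)) (toComplex m) := by
  induction p using vec_induction with
  | zero => simp
  | add p p' hp hp' => simp only [map_add, add_lie, hp, hp', add_dotProduct]; module
  | smul a p hp => simp only [map_smul, smul_lie, hp, smul_dotProduct, smul_eq_mul]; module
  | single i =>
    induction q using vec_induction with
    | zero => simp
    | add q q' hq hq' => simp only [map_add, lie_add, hq, hq', add_dotProduct]; module
    | smul a q hq => simp only [map_smul, lie_smul, hq, smul_dotProduct, smul_eq_mul]; module
    | single j =>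
      rw [Fintype.linearCombination_apply ℂ (K (m + k))]
      simp only [Fintype.linearCombination_apply_single, one_smul, hτ.lie_W_W,
        single_dotProduct, one_mul]

/-- To prove a property of all elements of `τ`, it suffices to treat the generators. -/
theorem induction_gens (hτ : IsFullToroidal n 𝔤 τ κ c₁ c₂ E K W) {P : τ → Prop}
    (hE : ∀ m x, P (E m x)) (hK : ∀ m i, P (K m i)) (hW : ∀ m i, P (W m i))
    (zero : P 0) (add : ∀ x y, P x → P y → P (x + y)) (smul : ∀ (a : ℂ) x, P x → P (a • x))
    (z : τ) : P z := by
  have hz : z ∈ Submodule.span ℂ _ := hτ.span_eq_top ▸ Submodule.mem_top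
  induction hz using Submodule.span_induction with
  | mem z h =>
    rcases h with (⟨m, x, rfl⟩ | ⟨m, i, rfl⟩) | ⟨m, i, rfl⟩
    exacts [hE m x, hK m i, hW m i]
  | zero => exact zero
  | add x y _ _ hx hy => exact add x y hx hy
  | smul a x _ hx => exact smul a x hx

end IsFullToroidal

/-- The linear map `(x, c, d) ↦ x ⊗ t^m + K(c, m) + D(d, m)` onto the graded piece of degree `m`. -/
noncomputable def homogeneous (E : (Fin n → ℤ) → 𝔤 →ₗ[ℂ] τ) (K W : (Fin n → ℤ) → Fin n → τ)
    (m : Fin n → ℤ) : (𝔤 × (Fin n → ℂ) × (Fin n → ℂ)) →ₗ[ℂ] τ :=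
  (E m).coprod ((comb (K m)).coprod (comb (W m)))

/-- The presentation of `τ` by its homogeneous generators. -/
noncomputable def presentation (E : (Fin n → ℤ) → 𝔤 →ₗ[ℂ] τ)
    (K W : (Fin n → ℤ) → Fin n → τ) :
    ((Fin n → ℤ) →₀ (𝔤 × (Fin n → ℂ) × (Fin n → ℂ))) →ₗ[ℂ] τ :=
  Finsupp.lsum ℂ (homogeneous E K W)

section Presentation

variable {E : (Fin n → ℤ) → 𝔤 →ₗ[ℂ] τ} {K W : (Fin n → ℤ) → Fin n → τ}

theorem homogeneous_apply (m : Fin n → ℤ) (x : 𝔤) (c d : Fin n → ℂ) :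
    homogeneous E K W m (x, c, d) = E m x + comb (K m) c + comb (W m) d := by
  simp [homogeneous, add_assoc]

theorem presentation_single (m : Fin n → ℤ) (v : 𝔤 × (Fin n → ℂ) × (Fin n → ℂ)) :
    presentation E K W (Finsupp.single m v) = homogeneous E K W m v := by
  simp [presentation]

theorem presentation_single_E (m : Fin n → ℤ) (x : 𝔤) :
    presentation E K W (Finsupp.single m (x, 0, 0)) = E m x := by
  simp [presentation_single, homogeneous_apply]

theorem presentation_single_K (m : Fin n → ℤ) (i : Fin n) :
    presentation E K W (Finsupp.single m (0, Pi.single i 1, 0)) = K m i := by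
  simp [presentation_single, homogeneous_apply, Fintype.linearCombination_apply_single]

theorem presentation_single_W (m : Fin n → ℤ) (i : Fin n) :
    presentation E K W (Finsupp.single m (0, 0, Pi.single i 1)) = W m i := by
  simp [presentation_single, homogeneous_apply, Fintype.linearCombination_apply_single]

theorem homogeneous_mem (m : Fin n → ℤ) (v : 𝔤 × (Fin n → ℂ) × (Fin n → ℂ)) :
    homogeneous E K W m v ∈ gradedPiece E K W m := by
  obtain ⟨x, c, d⟩ := v
  rw [homogeneous_apply, Fintype.linearCombination_apply, Fintype.linearCombination_apply]
  refine add_mem (add_mem (Submodule.subset_span (Or.inl (Or.inl ⟨x, rfl⟩)))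
    (Submodule.sum_mem _ fun i _ => Submodule.smul_mem _ _ ?_))
    (Submodule.sum_mem _ fun i _ => Submodule.smul_mem _ _ ?_)
  · exact Submodule.subset_span (Or.inl (Or.inr ⟨i, rfl⟩))
  · exact Submodule.subset_span (Or.inr ⟨i, rfl⟩)

theorem homogeneous_eq_zero_of_presentation_eq_zero (hfree : FreeGens E K W)
    {f : (Fin n → ℤ) →₀ (𝔤 × (Fin n → ℂ) × (Fin n → ℂ))} (hf : presentation E K W f = 0)
    (m : Fin n → ℤ) : homogeneous E K W m (f m) = 0 := by
  have hind : iSupIndep (gradedPiece E K W) := fun m =>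
    disjoint_iff.2 (hfree.graded_indep m)
  by_cases hm : m ∈ f.support
  · rw [iSupIndep_iff_finsetSum_eq_zero_imp_eq_zero] at hind
    exact hind f.support _ (fun k _ => homogeneous_mem k (f k)) hf m hm
  · rw [Finsupp.notMem_support_iff.1 hm, map_zero]

theorem presentation_surjective {κ : 𝔤 →ₗ[ℂ] 𝔤 →ₗ[ℂ] ℂ} {c₁ c₂ : ℂ}
    (hτ : IsFullToroidal n 𝔤 τ κ c₁ c₂ E K W) :
    Function.Surjective (presentation E K W) := fun z =>
  hτ.induction_gens (P := fun z => z ∈ LinearMap.range (presentation E K W))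
    (fun m x => ⟨_, presentation_single_E m x⟩) (fun m i => ⟨_, presentation_single_K m i⟩)
    (fun m i => ⟨_, presentation_single_W m i⟩) (zero_mem _) (fun _ _ => add_mem)
    (fun a _ => Submodule.smul_mem _ a) z

/-- Linear maps out of `τ` are determined by the images of the homogeneous generators, which are
subject only to the Kähler relations. -/
theorem exists_linearMap {κ : 𝔤 →ₗ[ℂ] 𝔤 →ₗ[ℂ] ℂ} {c₁ c₂ : ℂ}
    (hτ : IsFullToroidal n 𝔤 τ κ c₁ c₂ E K W) (hfree : FreeGens E K W)
    {τ' : Type} [LieRing τ'] [LieAlgebra ℂ τ']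
    (E' : (Fin n → ℤ) → 𝔤 →ₗ[ℂ] τ') (K' W' : (Fin n → ℤ) → Fin n → τ')
    (hK' : ∀ m, comb (K' m) (toComplex m) = 0) :
    ∃ f : τ →ₗ[ℂ] τ', (∀ m x, f (E m x) = E' m x) ∧ (∀ m i, f (K m i) = K' m i) ∧
      ∀ m i, f (W m i) = W' m i := by
  have hker : ∀ v, presentation E K W v = 0 → presentation E' K' W' v = 0 := by
    intro v hv
    refine Finset.sum_eq_zero fun m _ => ?_
    have h0 := homogeneous_eq_zero_of_presentation_eq_zero hfree hv m
    change homogeneous E' K' W' m (v m) = 0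
    generalize v m = u at h0 ⊢
    obtain ⟨x, c, d⟩ := u
    rw [homogeneous_apply] at h0 ⊢
    obtain ⟨hx, hd, t, ht⟩ := hfree.EKW_indep m x c d h0
    obtain rfl : d = 0 := funext hd
    obtain rfl : c = t • toComplex m := funext ht
    rw [hx, map_smul, hK']
    simp
  obtain ⟨s, hs⟩ := LinearMap.exists_rightInverse_of_surjective (presentation E K W)
    (LinearMap.range_eq_top.2 (presentation_surjective hτ))
  have hf : ∀ v, presentation E' K' W' (s (presentation E K W v)) = presentation E' K' W' v := by
    intro v
    rw [← sub_eq_zero, ← map_sub]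
    refine hker _ ?_
    rw [map_sub, sub_eq_zero]
    exact LinearMap.congr_fun hs _
  refine ⟨presentation E' K' W' ∘ₗ s, fun m x => ?_, fun m i => ?_, fun m i => ?_⟩
  · rw [LinearMap.comp_apply, ← presentation_single_E (K := K) (W := W), hf,
      presentation_single_E]
  · rw [LinearMap.comp_apply, ← presentation_single_K (E := E) (K := K) (W := W), hf,
      presentation_single_K]
  · rw [LinearMap.comp_apply, ← presentation_single_W (E := E) (K := K) (W := W), hf,
      presentation_single_W]

end Presentation

/-- `Φ` acts on the generators by the change of coordinates `t_i ↦ t^{α_i}`, where `b` is dual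
to `α`. -/
structure IsTwist (E : (Fin n → ℤ) → 𝔤 →ₗ[ℂ] τ) (K W : (Fin n → ℤ) → Fin n → τ)
    (α : Fin n → Fin n → ℤ) (b : Fin n → Fin n → ℂ) (Φ : τ →ₗ⁅ℂ⁆ τ) : Prop where
  map_E : ∀ m x, Φ (E m x) = E (∑ i, m i • α i) x
  map_K : ∀ m i, Φ (K m i) = comb (K (∑ p, m p • α p)) (toComplex (α i))
  map_W : ∀ m i, Φ (W m i) = comb (W (∑ p, m p • α p)) (b i)

section Twist

variable {κ : 𝔤 →ₗ[ℂ] 𝔤 →ₗ[ℂ] ℂ} {c₁ c₂ : ℂ}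
  {E : (Fin n → ℤ) → 𝔤 →ₗ[ℂ] τ} {K W : (Fin n → ℤ) → Fin n → τ}

theorem toComplex_sum_smul (m : Fin n → ℤ) (α : Fin n → Fin n → ℤ) :
    toComplex (∑ i, m i • α i) = ∑ i, (m i : ℂ) • toComplex (α i) := by
  ext j
  simp [toComplex]

theorem exists_isTwist (hτ : IsFullToroidal n 𝔤 τ κ c₁ c₂ E K W) (hfree : FreeGens E K W)
    (α : Fin n → Fin n → ℤ) (b : Fin n → Fin n → ℂ)
    (hdual : ∀ i j, b i ⬝ᵥ toComplex (α j) = if i = j then 1 else 0) :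
    ∃ Φ : τ →ₗ⁅ℂ⁆ τ, IsTwist E K W α b Φ := by
  set u : (Fin n → ℤ) → (Fin n → ℤ) := fun m => ∑ i, m i • α i with hu
  have hu_add : ∀ m k, u (m + k) = u m + u k := fun m k => by
    simp only [hu, Pi.add_apply, add_smul, Finset.sum_add_distrib]
  have hcomb : ∀ (m : Fin n → ℤ) (X : Fin n → τ),
      ∑ p, (m p : ℂ) • comb X (toComplex (α p)) = comb X (toComplex (u m)) := fun m X => by
    rw [hu, toComplex_sum_smul, map_sum]
    simp only [map_smul]
  have hdot : ∀ i m, b i ⬝ᵥ toComplex (u m) = (m i : ℂ) := fun i m => by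
    rw [hu, toComplex_sum_smul, dotProduct_sum]
    simp [dotProduct_smul, hdual]
  obtain ⟨f, hE, hK, hW⟩ := exists_linearMap hτ hfree (fun m => E (u m))
    (fun m i => comb (K (u m)) (toComplex (α i))) (fun m i => comb (W (u m)) (b i))
    (fun m => by
      rw [Fintype.linearCombination_apply, hcomb, hτ.comb_K_self])
  have hKsum : ∀ m k, f (∑ p, (m p : ℂ) • K (m + k) p)
      = comb (K (u m + u k)) (toComplex (u m)) := fun m k => by
    simp only [map_sum, map_smul, hK, hcomb, hu_add]
  have hEE : ∀ m x k y, f ⁅E m x, E k y⁆ = ⁅f (E m x), f (E k y)⁆ := fun m x k y => by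
    rw [hτ.lie_E_E, map_add, map_smul, hKsum, hE, hE, hE, hτ.lie_E_E, hu_add]
    rfl
  have hEK : ∀ m x k j, f ⁅E m x, K k j⁆ = ⁅f (E m x), f (K k j)⁆ := fun m x k j => by
    rw [hτ.lie_E_K, hE, hK, hτ.lie_E_comb_K, map_zero]
  have hKK : ∀ m i k j, f ⁅K m i, K k j⁆ = ⁅f (K m i), f (K k j)⁆ := fun m i k j => by
    rw [hτ.lie_K_K, hK, hK, hτ.lie_comb_K_comb_K, map_zero]
  have hWE : ∀ m i k x, f ⁅W m i, E k x⁆ = ⁅f (W m i), f (E k x)⁆ := fun m i k x => by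
    rw [hτ.lie_W_E, hW, hE, map_smul, hE, hτ.lie_comb_W_E, hdot, hu_add]
  have hWK : ∀ m i k j, f ⁅W m i, K k j⁆ = ⁅f (W m i), f (K k j)⁆ := fun m i k j => by
    rw [hτ.lie_W_K, hW, hK, map_add, map_smul, hK, hτ.lie_comb_W_comb_K, hdot, hu_add, hdual,
      apply_ite f, hKsum, map_zero, ite_smul, one_smul, zero_smul]
  have hWW : ∀ m i k j, f ⁅W m i, W k j⁆ = ⁅f (W m i), f (W k j)⁆ := fun m i k j => by
    rw [hτ.lie_W_W, hW, hW, map_add, map_sub, map_smul, map_smul, map_smul, hW, hW, hKsum,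
      hτ.lie_comb_W_comb_W, hdot, hdot, hdot, hdot, hu_add]
  have hswap : ∀ x y, f ⁅x, y⁆ = ⁅f x, f y⁆ → f ⁅y, x⁆ = ⁅f y, f x⁆ := fun x y h => by
    rw [← lie_skew, map_neg, h, lie_skew]
  have hlie : ∀ x y, f ⁅x, y⁆ = ⁅f x, f y⁆ := by
    intro x y
    have ext_right : ∀ x, (∀ m z, f ⁅x, E m z⁆ = ⁅f x, f (E m z)⁆) →
        (∀ m i, f ⁅x, K m i⁆ = ⁅f x, f (K m i)⁆) →
        (∀ m i, f ⁅x, W m i⁆ = ⁅f x, f (W m i)⁆) → f ⁅x, y⁆ = ⁅f x, f y⁆ :=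
      fun x h₁ h₂ h₃ => hτ.induction_gens (P := fun y => f ⁅x, y⁆ = ⁅f x, f y⁆) h₁ h₂ h₃
        (by simp) (fun a b ha hb => by simp only [lie_add, map_add, ha, hb])
        (fun a b hb => by simp only [lie_smul, map_smul, hb]) y
    refine hτ.induction_gens (P := fun x => f ⁅x, y⁆ = ⁅f x, f y⁆) (fun m x => ?_)
      (fun m i => ?_) (fun m i => ?_)
      (by simp) (fun a b ha hb => by simp only [add_lie, map_add, ha, hb])
      (fun a b hb => by simp only [smul_lie, map_smul, hb]) x
    · exact ext_right _ (hEE m x) (hEK m x) fun k j => hswap _ _ (hWE k j m x)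
    · exact ext_right _ (fun k x => hswap _ _ (hEK k x m i)) (hKK m i)
        fun k j => hswap _ _ (hWK k j m i)
    · exact ext_right _ (hWE m i) (hWK m i) (hWW m i)
  exact ⟨{ f with map_lie' := fun {x y} => hlie x y }, hE, hK, hW⟩

theorem IsTwist.map_comb_K {α : Fin n → Fin n → ℤ} {b : Fin n → Fin n → ℂ} {Φ : τ →ₗ⁅ℂ⁆ τ}
    (h : IsTwist E K W α b Φ) (m : Fin n → ℤ) (c : Fin n → ℂ) :
    Φ (comb (K m) c) = comb (K (∑ p, m p • α p)) (∑ i, c i • toComplex (α i)) := by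
  rw [Fintype.linearCombination_apply, map_sum, map_sum]
  simp only [map_smul, h.map_K]

theorem IsTwist.map_comb_W {α : Fin n → Fin n → ℤ} {b : Fin n → Fin n → ℂ} {Φ : τ →ₗ⁅ℂ⁆ τ}
    (h : IsTwist E K W α b Φ) (m : Fin n → ℤ) (c : Fin n → ℂ) :
    Φ (comb (W m) c) = comb (W (∑ p, m p • α p)) (∑ i, c i • b i) := by
  rw [Fintype.linearCombination_apply, map_sum, map_sum]
  simp only [map_smul, h.map_W]

theorem sum_smul_sum_smul {α α' : Fin n → Fin n → ℤ}
    (hα : ∀ i, ∑ p, α i p • α' p = Pi.single i 1) (m : Fin n → ℤ) :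
    ∑ p, (∑ i, m i • α i) p • α' p = m := by
  have h : ∀ q, ∑ p, (∑ i, m i • α i) p * α' p q = m q := fun q => by
    simp only [Finset.sum_apply, Pi.smul_apply, smul_eq_mul, Finset.sum_mul]
    rw [Finset.sum_comm]
    have := fun i => congrFun (hα i) q
    simp only [Finset.sum_apply, Pi.smul_apply, smul_eq_mul] at this
    simp only [mul_assoc, ← Finset.mul_sum, this]
    simp [Pi.single_apply]
  ext q
  simpa using h q

theorem IsTwist.leftInverse (hτ : IsFullToroidal n 𝔤 τ κ c₁ c₂ E K W)
    {α α' : Fin n → Fin n → ℤ} {b b' : Fin n → Fin n → ℂ} {Φ Ψ : τ →ₗ⁅ℂ⁆ τ}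
    (hΦ : IsTwist E K W α b Φ) (hΨ : IsTwist E K W α' b' Ψ)
    (hα : ∀ i, ∑ p, α i p • α' p = Pi.single i 1)
    (hb : ∀ i, ∑ p, b i p • b' p = Pi.single i 1) :
    Function.LeftInverse Ψ Φ := by
  intro z
  refine hτ.induction_gens (P := fun z => Ψ (Φ z) = z) (fun m x => ?_) (fun m i => ?_)
    (fun m i => ?_) (by simp) (fun x y hx hy => by rw [map_add, map_add, hx, hy])
    (fun a x hx => by rw [map_smul, map_smul, hx]) z
  · rw [hΦ.map_E, hΨ.map_E, sum_smul_sum_smul hα]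
  · have h : ∑ p, (α i p : ℂ) • toComplex (α' p) = Pi.single i 1 := by
      rw [← toComplex_sum_smul, hα]
      ext j
      simp [toComplex, Pi.single_apply]
    rw [hΦ.map_K, hΨ.map_comb_K, sum_smul_sum_smul hα, h,
      Fintype.linearCombination_apply_single, one_smul]
  · rw [hΦ.map_W, hΨ.map_comb_W, sum_smul_sum_smul hα, hb,
      Fintype.linearCombination_apply_single, one_smul]

/-- If the change of coordinates sends the degrees in `S` into `T`, then it maps the subalgebra
generated in degrees `S` into the one generated in degrees `T`. -/
theorem IsTwist.map_lieSpan_le {α : Fin n → Fin n → ℤ} {b : Fin n → Fin n → ℂ}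
    {Φ : τ →ₗ⁅ℂ⁆ τ} (h : IsTwist E K W α b Φ) {S T : Set (Fin n → ℤ)}
    (hST : ∀ m ∈ S, ∑ i, m i • α i ∈ T) :
    (LieSubalgebra.lieSpan ℂ τ {Y | ∃ m ∈ S, Y ∈ genOfDeg E K W m}).map Φ ≤
      LieSubalgebra.lieSpan ℂ τ {Y | ∃ m ∈ T, Y ∈ genOfDeg E K W m} := by
  rw [LieSubalgebra.map_le_iff_le_comap, LieSubalgebra.lieSpan_le]
  rintro Y ⟨m, hm, (⟨x, rfl⟩ | ⟨i, rfl⟩) | ⟨i, rfl⟩⟩ <;>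
    simp only [SetLike.mem_coe, LieSubalgebra.mem_comap]
  · rw [h.map_E]
    exact LieSubalgebra.subset_lieSpan ⟨_, hST m hm, Or.inl (Or.inl ⟨x, rfl⟩)⟩
  · rw [h.map_K, Fintype.linearCombination_apply]
    exact sum_mem fun j _ => LieSubalgebra.smul_mem _ _
      (LieSubalgebra.subset_lieSpan ⟨_, hST m hm, Or.inl (Or.inr ⟨j, rfl⟩)⟩)
  · rw [h.map_W, Fintype.linearCombination_apply]
    exact sum_mem fun j _ => LieSubalgebra.smul_mem _ _
      (LieSubalgebra.subset_lieSpan ⟨_, hST m hm, Or.inr ⟨j, rfl⟩⟩)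

end Twist

/-- A basis of `M` together with a generator of a complement of `M` is a unimodular matrix. -/
theorem exists_integral_inverse {M : AddSubgroup (Fin n → ℤ)} {α : Fin n → Fin n → ℤ} {i₀ : Fin n}
    (hcompl : IsCompl M (AddSubgroup.zmultiples (α i₀)))
    (hM : ∀ m ∈ M, ∃ c : Fin n → ℤ, m = ∑ i, c i • α i) :
    ∃ α' : Matrix (Fin n) (Fin n) ℤ, α' * Matrix.of α = 1 := by
  have hspan : ∀ m : Fin n → ℤ, ∃ c : Fin n → ℤ, ∑ i, c i • α i = m := by
    intro m
    have hm : m ∈ M ⊔ AddSubgroup.zmultiples (α i₀) := by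
      rw [hcompl.sup_eq_top]; trivial
    obtain ⟨y, hy, z, hz, rfl⟩ := AddSubgroup.mem_sup.1 hm
    obtain ⟨k, rfl⟩ := AddSubgroup.mem_zmultiples_iff.1 hz
    obtain ⟨c, rfl⟩ := hM y hy
    exact ⟨c + Pi.single i₀ k, by
      simp [add_smul, Finset.sum_add_distrib, Pi.single_apply, ite_smul]⟩
  choose c hc using fun p : Fin n => hspan (Pi.single p 1)
  refine ⟨Matrix.of c, ?_⟩
  ext p q
  have := congrFun (hc p) q
  simp only [Finset.sum_apply, Pi.smul_apply, smul_eq_mul] at this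
  simp [Matrix.mul_apply, this, Matrix.one_apply, Pi.single_apply, eq_comm]

theorem statement_16
    (n : ℕ) (hn : 3 ≤ n)
    (𝔤 : Type) [LieRing 𝔤] [LieAlgebra ℂ 𝔤] [LieAlgebra.IsSimple ℂ 𝔤]
    [FiniteDimensional ℂ 𝔤]
    (τ : Type) [LieRing τ] [LieAlgebra ℂ τ]
    (κ : 𝔤 →ₗ[ℂ] 𝔤 →ₗ[ℂ] ℂ) (c₁ c₂ : ℂ)
    (E : (Fin n → ℤ) → 𝔤 →ₗ[ℂ] τ) (K W : (Fin n → ℤ) → Fin n → τ)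
    (hτ : IsFullToroidal n 𝔤 τ κ c₁ c₂ E K W) (hfree : FreeGens E K W)
    (M : AddSubgroup (Fin n → ℤ)) (α : Fin n → (Fin n → ℤ))
    (βd : Fin n → (Fin n → ℂ))
    -- `ℤⁿ = ℤα₁ ⊕ M`
    (hcompl : IsCompl M (AddSubgroup.zmultiples (α (⟨0, by omega⟩ : Fin n))))
    -- `α₂, …, α_n` is a `ℤ`-basis of `M`
    (hαM : ∀ i : Fin n, i ≠ (⟨0, by omega⟩ : Fin n) → α i ∈ M)
    (hbasis : ∀ m ∈ M, ∃! c : Fin n → ℤ,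
      c (⟨0, by omega⟩ : Fin n) = 0 ∧ m = ∑ i, c i • α i)
    -- `β₁, …, β_n` is the dual basis of `α₁, …, α_n`
    (hdual : ∀ i j : Fin n,
      (∑ p, βd i p * (α j p : ℂ)) = if i = j then 1 else 0) :
    ∃ e : ↥(LieSubalgebra.lieSpan ℂ τ
            {Y | ∃ m : Fin n → ℤ, m (⟨0, by omega⟩ : Fin n) = 0 ∧
              Y ∈ genOfDeg E K W m}) ≃ₗ⁅ℂ⁆
          ↥(LieSubalgebra.lieSpan ℂ τ (tauMGens E K W M)),
      (∀ (m : Fin n → ℤ) (_ : m (⟨0, by omega⟩ : Fin n) = 0) (x : 𝔤)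
        (h : E m x ∈ LieSubalgebra.lieSpan ℂ τ
          {Y | ∃ m : Fin n → ℤ, m (⟨0, by omega⟩ : Fin n) = 0 ∧
            Y ∈ genOfDeg E K W m}),
        ((e ⟨E m x, h⟩ : τ) = E (∑ i, m i • α i) x)) ∧
      (∀ (m : Fin n → ℤ) (_ : m (⟨0, by omega⟩ : Fin n) = 0) (i : Fin n)
        (h : K m i ∈ LieSubalgebra.lieSpan ℂ τ
          {Y | ∃ m : Fin n → ℤ, m (⟨0, by omega⟩ : Fin n) = 0 ∧
            Y ∈ genOfDeg E K W m}),
        ((e ⟨K m i, h⟩ : τ) = ∑ j, (α i j : ℂ) • K (∑ p, m p • α p) j)) ∧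
      (∀ (m : Fin n → ℤ) (_ : m (⟨0, by omega⟩ : Fin n) = 0) (i : Fin n)
        (h : W m i ∈ LieSubalgebra.lieSpan ℂ τ
          {Y | ∃ m : Fin n → ℤ, m (⟨0, by omega⟩ : Fin n) = 0 ∧
            Y ∈ genOfDeg E K W m}),
        ((e ⟨W m i, h⟩ : τ) = ∑ j, βd i j • W (∑ p, m p • α p) j)) := by
  obtain ⟨A', hA'⟩ := exists_integral_inverse hcompl fun m hm => by
    obtain ⟨c, ⟨_, hc⟩, _⟩ := hbasis m hm
    exact ⟨c, hc⟩
  set i₀ : Fin n := ⟨0, by omega⟩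
  have hA := mul_eq_one_comm.1 hA'
  have hα'α : ∀ i, ∑ p, A' i p • α p = Pi.single i 1 := fun i => by
    ext q
    simpa [Matrix.mul_apply, Matrix.one_apply, Pi.single_apply, eq_comm]
      using congrFun (congrFun hA' i) q
  have hαα' : ∀ i, ∑ p, α i p • A' p = Pi.single i 1 := fun i => by
    ext q
    simpa [Matrix.mul_apply, Matrix.one_apply, Pi.single_apply, eq_comm]
      using congrFun (congrFun hA i) q
  -- the dual basis of the rows of `A'` consists of the columns of `α`
  let b' : Fin n → Fin n → ℂ := fun p i => (α i p : ℂ)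
  have hbb' : ∀ i, ∑ p, βd i p • b' p = Pi.single i 1 := fun i => by
    ext q
    simpa [b', Pi.single_apply, eq_comm] using hdual i q
  have hb'b : ∀ i, ∑ p, b' i p • βd p = Pi.single i 1 := fun i => by
    have h : Matrix.of βd * Matrix.of b' = 1 := by
      ext i q
      simpa [b', Matrix.mul_apply, Matrix.one_apply] using hdual i q
    have h' := mul_eq_one_comm.1 h
    ext q
    simpa [Matrix.mul_apply, Matrix.one_apply, Pi.single_apply, eq_comm]
      using congrFun (congrFun h' i) q
  have hdual' : ∀ i j, b' i ⬝ᵥ toComplex (A' j) = if i = j then 1 else 0 := fun i j => by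
    have h := congrArg (Int.cast : ℤ → ℂ) (congrFun (congrFun hA' j) i)
    simp only [Matrix.mul_apply, Matrix.one_apply, Matrix.of_apply] at h
    push_cast at h
    simpa [dotProduct, b', mul_comm, eq_comm] using h
  obtain ⟨Φ, hΦ⟩ := exists_isTwist hτ hfree α βd hdual
  obtain ⟨Ψ, hΨ⟩ := exists_isTwist hτ hfree A' b' hdual'
  have hΦΨ := hΨ.leftInverse hτ hΦ hα'α hb'b
  let e : τ ≃ₗ⁅ℂ⁆ τ :=
    { Φ with
      invFun := Ψ
      left_inv := hΦ.leftInverse hτ hΨ hαα' hbb'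
      right_inv := hΦΨ }
  have hmap : (LieSubalgebra.lieSpan ℂ τ
      {Y | ∃ m : Fin n → ℤ, m i₀ = 0 ∧ Y ∈ genOfDeg E K W m}).map e.toLieHom =
      LieSubalgebra.lieSpan ℂ τ (tauMGens E K W M) := by
    refine le_antisymm (hΦ.map_lieSpan_le (S := {m | m i₀ = 0}) (T := M) fun m hm => ?_) ?_
    · refine sum_mem fun i _ => ?_
      by_cases hi : i = i₀
      · rw [hi, show m i₀ = 0 from hm, zero_smul]
        exact M.zero_mem
      · exact M.zsmul_mem (hαM i hi) _
    · intro z hz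
      refine ⟨Ψ z, hΨ.map_lieSpan_le (S := M) (T := {m | m i₀ = 0}) (fun m hm => ?_)
        ⟨z, hz, rfl⟩, hΦΨ z⟩
      obtain ⟨c, ⟨hc₀, rfl⟩, _⟩ := hbasis m hm
      rwa [sum_smul_sum_smul hαα']
  exact ⟨LieEquiv.ofSubalgebras _ _ e hmap, fun m _ x _ => hΦ.map_E m x,
    fun m _ i _ => hΦ.map_K m i, fun m _ i _ => hΦ.map_W m i⟩

end MT
end

section
/- The Witt algebra W_n (the Lie algebra of derivations of the Laurent polynomial ring A_n = ℂ[t_1^{±1},…,t_n^{±1}]) is generated as a Lie algebra by the set { t_k^j d_i : j ∈ ℤ, 1 ≤ i, k ≤ n }, where d_i = t_i ∂/∂t_i. -/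
open scoped TensorProduct

namespace MT

variable {n : ℕ} {𝔤 : Type} [LieRing 𝔤] [LieAlgebra ℂ 𝔤]
variable {τ : Type} [LieRing τ] [LieAlgebra ℂ τ]

theorem mem_of_bracket_of_forall_single_mem {n : ℕ} {L : Type*} [LieRing L] [LieAlgebra ℂ L]
    {W : (Fin n → ℤ) → Fin n → L}
    (hbr : ∀ m k : Fin n → ℤ, ∀ i j : Fin n,
      ⁅W m i, W k j⁆ = (k i : ℂ) • W (m + k) j - (m j : ℂ) • W (m + k) i)
    {S : LieSubalgebra ℂ L} (hS : ∀ (j : ℤ) (i k : Fin n), W (Pi.single k j) i ∈ S)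
    (m : Fin n → ℤ) (i : Fin n) : W m i ∈ S := by
  suffices h : ∀ s : Finset (Fin n), ∀ m : Fin n → ℤ, (∀ k ∉ s, m k = 0) → ∀ i, W m i ∈ S from
    h Finset.univ m (by simp) i
  intro s
  induction s using Finset.induction_on with
  | empty =>
    intro m hm i
    have hm0 : m = Pi.single i 0 := by ext k; simp [hm k]
    exact hm0 ▸ hS 0 i i
  | insert k s _ ih =>
    intro m hm
    by_cases hk : m k = 0
    · refine ih m fun l hl => ?_
      by_cases hlk : l = k
      · rwa [hlk]
      · exact hm l (by simp [hlk, hl])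
    have hp : ∀ i, W (Function.update m k 0) i ∈ S := by
      refine ih _ fun l hl => ?_
      by_cases hlk : l = k
      · simp [hlk]
      · rw [Function.update_of_ne hlk]
        exact hm l (by simp [hlk, hl])
    have hsum : Function.update m k 0 + Pi.single k (m k) = m := by
      ext l
      by_cases hlk : l = k
      · subst hlk; simp
      · simp [hlk]
    have hc : (m k : ℂ) ≠ 0 := Int.cast_ne_zero.mpr hk
    have hmem (j : Fin n) :
        (m k : ℂ) • W m j - ((Function.update m k 0 j : ℤ) : ℂ) • W m k ∈ S := by
      have h := S.lie_mem (hp k) (hS (m k) j k)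
      rwa [hbr, hsum, Pi.single_eq_same] at h
    have hWk : W m k ∈ S := by
      have h := hmem k
      rw [Function.update_self, Int.cast_zero, zero_smul, sub_zero] at h
      exact (S.toSubmodule.smul_mem_iff hc).mp h
    intro j
    refine (S.toSubmodule.smul_mem_iff hc).mp ?_
    simpa using S.add_mem (hmem j) (S.smul_mem ((Function.update m k 0 j : ℤ) : ℂ) hWk)

theorem statement_17
    (n : ℕ) (hn : 1 ≤ n)
    (Wn : Type) [LieRing Wn] [LieAlgebra ℂ Wn]
    (W : (Fin n → ℤ) → Fin n → Wn)
    (hspan : Submodule.span ℂ {z : Wn | ∃ m i, z = W m i} = ⊤)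
    (hbr : ∀ m k : Fin n → ℤ, ∀ i j : Fin n,
      ⁅W m i, W k j⁆ = (k i : ℂ) • W (m + k) j - (m j : ℂ) • W (m + k) i) :
    LieSubalgebra.lieSpan ℂ Wn
      {z : Wn | ∃ (j : ℤ) (i k : Fin n), z = W (Pi.single k j) i} = ⊤ := by
  rw [← LieSubalgebra.toSubmodule_inj, LieSubalgebra.top_toSubmodule, eq_top_iff, ← hspan,
    Submodule.span_le]
  rintro _ ⟨m, i, rfl⟩
  exact mem_of_bracket_of_forall_single_mem hbr
    (S := LieSubalgebra.lieSpan ℂ Wn {z : Wn | ∃ (j : ℤ) (i k : Fin n), z = W (Pi.single k j) i})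
    (fun j i k => LieSubalgebra.subset_lieSpan ⟨j, i, k, rfl⟩) m i

end MT
end

section
/- The center of the map full toroidal Lie algebra τ(B) = τ ⊗ B equals span_ℂ{ K_i ⊗ a : 1 ≤ i ≤ n, a ∈ B } = (span_ℂ{K_1,…,K_n}) ⊗ B; in particular it is infinite dimensional whenever B is. -/
open scoped TensorProduct

namespace MT

variable {n : ℕ} {𝔤 : Type} [LieRing 𝔤] [LieAlgebra ℂ 𝔤]
variable {τ : Type} [LieRing τ] [LieAlgebra ℂ τ]

section Center

variable {κ : 𝔤 →ₗ[ℂ] 𝔤 →ₗ[ℂ] ℂ} {c₁ c₂ : ℂ}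
  {E : (Fin n → ℤ) → 𝔤 →ₗ[ℂ] τ} {K W : (Fin n → ℤ) → Fin n → τ}

/-- An element commuting with all homogeneous generators is central. -/
lemma IsFullToroidal.mem_center_of_generators (hτ : IsFullToroidal n 𝔤 τ κ c₁ c₂ E K W) {z : τ}
    (hE : ∀ m x, ⁅E m x, z⁆ = 0) (hK : ∀ m i, ⁅K m i, z⁆ = 0) (hW : ∀ m i, ⁅W m i, z⁆ = 0) :
    z ∈ LieAlgebra.center ℂ τ := by
  rw [LieModule.mem_maxTrivSubmodule]
  intro x
  have hx : x ∈ (⊤ : Submodule ℂ τ) := Submodule.mem_top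
  rw [← hτ.span_eq_top] at hx
  induction hx using Submodule.span_induction with
  | mem x hx =>
    rcases hx with (⟨m, x, rfl⟩ | ⟨m, i, rfl⟩) | ⟨m, i, rfl⟩
    · exact hE m x
    · exact hK m i
    · exact hW m i
  | zero => exact zero_lie z
  | add x y _ _ hx hy => rw [add_lie, hx, hy, add_zero]
  | smul c x _ hx => rw [smul_lie, hx, smul_zero]

lemma IsFullToroidal.K_zero_mem_center (hτ : IsFullToroidal n 𝔤 τ κ c₁ c₂ E K W) (j : Fin n) :
    K 0 j ∈ LieAlgebra.center ℂ τ := by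
  refine hτ.mem_center_of_generators (fun m x => hτ.lie_E_K m x 0 j)
    (fun m i => hτ.lie_K_K m i 0 j) fun m i => ?_
  simp [hτ.lie_W_K, hτ.K_rel]

lemma IsFullToroidal.iSup_gradedPiece (hτ : IsFullToroidal n 𝔤 τ κ c₁ c₂ E K W) :
    ⨆ m, gradedPiece E K W m = ⊤ := by
  rw [eq_top_iff, ← hτ.span_eq_top, Submodule.span_le]
  rintro _ ((⟨m, x, rfl⟩ | ⟨m, i, rfl⟩) | ⟨m, i, rfl⟩) <;>
    refine Submodule.mem_iSup_of_mem m (Submodule.subset_span ?_)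
  · exact Or.inl (Or.inl ⟨x, rfl⟩)
  · exact Or.inl (Or.inr ⟨i, rfl⟩)
  · exact Or.inr ⟨i, rfl⟩

/-- The degree operators act on homogeneous elements by their degree. -/
lemma IsFullToroidal.lie_W_zero_of_mem (hτ : IsFullToroidal n 𝔤 τ κ c₁ c₂ E K W)
    {m : Fin n → ℤ} {y : τ} (hy : y ∈ gradedPiece E K W m) (i : Fin n) :
    ⁅W 0 i, y⁆ = (m i : ℂ) • y := by
  induction hy using Submodule.span_induction with
  | mem y hy =>
    rcases hy with (⟨x, rfl⟩ | ⟨j, rfl⟩) | ⟨j, rfl⟩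
    · simp [hτ.lie_W_E]
    · simp [hτ.lie_W_K]
    · simp [hτ.lie_W_W]
  | zero => simp
  | add x y _ _ hx hy => rw [lie_add, hx, hy, smul_add]
  | smul c x _ hx => rw [lie_smul, hx, smul_comm]

lemma exists_eq_of_mem_gradedPiece {m : Fin n → ℤ} {y : τ} (hy : y ∈ gradedPiece E K W m) :
    ∃ (x : 𝔤) (c d : Fin n → ℂ), y = E m x + ∑ i, c i • K m i + ∑ i, d i • W m i := by
  rw [gradedPiece, genOfDeg, Submodule.span_union, Submodule.span_union] at hy
  obtain ⟨u, hu, w, hw, rfl⟩ := Submodule.mem_sup.1 hy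
  obtain ⟨e, he, k, hk, rfl⟩ := Submodule.mem_sup.1 hu
  obtain ⟨c, rfl⟩ := (Submodule.mem_span_range_iff_exists_fun ℂ).1 hk
  obtain ⟨d, rfl⟩ := (Submodule.mem_span_range_iff_exists_fun ℂ).1 hw
  rw [← LinearMap.coe_range, Submodule.span_eq] at he
  obtain ⟨x, rfl⟩ := he
  exact ⟨x, c, d, rfl⟩

/-- Central elements of `τ` are homogeneous of degree zero. -/
lemma IsFullToroidal.mem_gradedPiece_zero_of_mem_center
    (hτ : IsFullToroidal n 𝔤 τ κ c₁ c₂ E K W) (hfree : FreeGens E K W) {z : τ}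
    (hz : z ∈ LieAlgebra.center ℂ τ) : z ∈ gradedPiece E K W 0 := by
  have hmem : z ∈ ⨆ m, gradedPiece E K W m := hτ.iSup_gradedPiece ▸ Submodule.mem_top
  obtain ⟨f, hf, rfl⟩ := (Submodule.mem_iSup_iff_exists_finsupp _ _).1 hmem
  refine Submodule.sum_mem _ fun m hm => ?_
  obtain rfl | hm0 := eq_or_ne m 0
  · exact hf 0
  obtain ⟨i, hi⟩ := Function.ne_iff.1 hm0
  have hsum : ∑ k ∈ f.support, (k i : ℂ) • f k = 0 := by
    have h := hz (W 0 i)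
    rw [Finsupp.sum, lie_sum] at h
    simpa only [hτ.lie_W_zero_of_mem (hf _)] using h
  rw [← Finset.add_sum_erase _ _ hm, add_eq_zero_iff_eq_neg] at hsum
  have hbot : (m i : ℂ) • f m ∈ gradedPiece E K W m ⊓
      (⨆ k : Fin n → ℤ, ⨆ _ : k ≠ m, gradedPiece E K W k) := by
    refine ⟨Submodule.smul_mem _ _ (hf m), ?_⟩
    rw [hsum]
    refine Submodule.neg_mem _ (Submodule.sum_mem _ fun k hk => Submodule.smul_mem _ _ ?_)
    exact Submodule.mem_iSup_of_mem k
      (Submodule.mem_iSup_of_mem (Finset.ne_of_mem_erase hk) (hf k))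
  rw [hfree.graded_indep, Submodule.mem_bot, smul_eq_zero] at hbot
  rcases hbot with h | h
  · exact absurd (Int.cast_eq_zero.1 h) hi
  · rw [h]; exact Submodule.zero_mem _

lemma FreeGens.K_ne_zero (hfree : FreeGens E K W) {m : Fin n → ℤ} {j : Fin n} (hj : m j = 0) :
    K m j ≠ 0 := by
  intro h
  obtain ⟨t, ht⟩ := hfree.K_indep m (Pi.single j 1) (by simp [Pi.single_apply, h])
  simpa [hj] using ht j

/-- The center of `τ` is contained in the span of the `K_i`. -/
lemma IsFullToroidal.mem_span_K_zero_of_mem_center [LieAlgebra.IsSimple ℂ 𝔤]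
    [FiniteDimensional ℂ 𝔤] (hn : 2 ≤ n)
    (hτ : IsFullToroidal n 𝔤 τ κ c₁ c₂ E K W) (hfree : FreeGens E K W) {z : τ}
    (hz : z ∈ LieAlgebra.center ℂ τ) : z ∈ Submodule.span ℂ (Set.range (K 0)) := by
  obtain ⟨x, c, d, rfl⟩ :=
    exists_eq_of_mem_gradedPiece (hτ.mem_gradedPiece_zero_of_mem_center hfree hz)
  have hd : d = 0 := by
    funext i
    have : Nontrivial (Fin n) := Fin.nontrivial_iff_two_le.2 hn
    obtain ⟨j, hj⟩ := exists_ne i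
    have h := hz (K (Pi.single i 1) j)
    rw [← lie_skew, neg_eq_zero] at h
    simp only [add_lie, sum_lie, smul_lie, hτ.lie_E_K, hτ.lie_K_K, hτ.lie_W_K] at h
    have h' : d i • K (Pi.single i 1) j = 0 := by
      simpa [Pi.single_apply, Finset.sum_ite_eq] using h
    exact (smul_eq_zero.1 h').resolve_right (hfree.K_ne_zero (by simp [hj]))
  subst hd
  have hx : x ∈ LieAlgebra.center ℂ 𝔤 := by
    rw [LieModule.mem_maxTrivSubmodule]
    intro y
    have hK : ∀ i, ⁅E 0 y, K 0 i⁆ = 0 := fun i => hτ.lie_E_K 0 y 0 i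
    have h := hz (E 0 y)
    refine hfree.E_inj 0 _ ?_
    simpa [lie_sum, hK, hτ.lie_E_E] using h
  rw [LieAlgebra.center_eq_bot, LieSubmodule.mem_bot] at hx
  subst hx
  rw [Submodule.mem_span_range_iff_exists_fun]
  exact ⟨c, by simp⟩

end Center

section MapAlgebra

variable {B : Type} [CommRing B] [Algebra ℂ B]

lemma tmul_mem_center {X : τ} (hX : X ∈ LieAlgebra.center ℂ τ) (a : B) :
    a ⊗ₜ[ℂ] X ∈ LieAlgebra.center ℂ (B ⊗[ℂ] τ) := by
  rw [LieModule.mem_maxTrivSubmodule]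
  intro w
  induction w using TensorProduct.induction_on with
  | zero => exact zero_lie _
  | tmul b Y => rw [LieAlgebra.ExtendScalars.bracket_tmul, hX Y, TensorProduct.tmul_zero]
  | add u v hu hv => rw [add_lie, hu, hv, add_zero]

/-- A central element of `τ ⊗ B` is a sum of pure tensors whose factors in `τ` are central. -/
lemma exists_sum_of_mem_center {z : B ⊗[ℂ] τ} (hz : z ∈ LieAlgebra.center ℂ (B ⊗[ℂ] τ)) :
    ∃ f : B →₀ τ, (∀ b, f b ∈ LieAlgebra.center ℂ τ) ∧ (f.sum fun b X => b ⊗ₜ[ℂ] X) = z := by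
  classical
  let b := Module.Basis.ofVectorSpace ℂ B
  let e := TensorProduct.equivFinsuppOfBasisLeft (N := τ) b
  have he : ∀ (X : τ) (w : B ⊗[ℂ] τ) i, e ⁅(1 : B) ⊗ₜ[ℂ] X, w⁆ i = ⁅X, e w i⁆ := by
    intro X w i
    induction w using TensorProduct.induction_on with
    | zero => simp
    | tmul a Y => simp [e]
    | add u v hu hv => rw [lie_add, map_add, map_add, Finsupp.add_apply, hu, hv,
        Finsupp.add_apply, lie_add]
  refine ⟨(e z).embDomain ⟨b, b.injective⟩, fun a => ?_, ?_⟩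
  · by_cases ha : a ∈ Set.range b
    · obtain ⟨i, rfl⟩ := ha
      have h : (e z).embDomain ⟨b, b.injective⟩ (b i) = e z i :=
        Finsupp.embDomain_apply_self ⟨b, b.injective⟩ (e z) i
      rw [h, LieModule.mem_maxTrivSubmodule]
      intro X
      rw [← he, hz, map_zero, Finsupp.zero_apply]
    · rw [Finsupp.embDomain_of_notMem_range _ _ _ ha]
      exact zero_mem _
  · rw [Finsupp.sum_embDomain]
    exact (TensorProduct.equivFinsuppOfBasisLeft_symm_apply b (e z)).symm.trans
      (e.symm_apply_apply z)

lemma tmul_left_injective {X : τ} (hX : X ≠ 0) :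
    Function.Injective fun a : B => a ⊗ₜ[ℂ] X := by
  obtain ⟨g, hg⟩ := Module.Projective.exists_dual_ne_zero ℂ hX
  intro a a' h
  have h' := congrArg (fun w => TensorProduct.rid ℂ B (g.lTensor B w)) h
  simpa [hg] using h'

end MapAlgebra

theorem statement_18
    (n : ℕ) (hn : 3 ≤ n)
    (𝔤 : Type) [LieRing 𝔤] [LieAlgebra ℂ 𝔤] [LieAlgebra.IsSimple ℂ 𝔤]
    [FiniteDimensional ℂ 𝔤]
    (τ : Type) [LieRing τ] [LieAlgebra ℂ τ]
    (κ : 𝔤 →ₗ[ℂ] 𝔤 →ₗ[ℂ] ℂ) (c₁ c₂ : ℂ)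
    (E : (Fin n → ℤ) → 𝔤 →ₗ[ℂ] τ) (K W : (Fin n → ℤ) → Fin n → τ)
    (hτ : IsFullToroidal n 𝔤 τ κ c₁ c₂ E K W)
    (B : Type) [CommRing B] [Algebra ℂ B] [Nontrivial B]
    (hB : Algebra.FiniteType ℂ B)
    (hfree : FreeGens E K W) :
    (∀ z : B ⊗[ℂ] τ, z ∈ LieAlgebra.center ℂ (B ⊗[ℂ] τ) ↔
      z ∈ Submodule.span ℂ
        {w : B ⊗[ℂ] τ | ∃ (i : Fin n) (a : B), w = a ⊗ₜ[ℂ] K 0 i}) ∧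
    (¬ FiniteDimensional ℂ B →
      ¬ FiniteDimensional ℂ ↥(LieAlgebra.center ℂ (B ⊗[ℂ] τ))) := by
  have hcenter : ∀ (i : Fin n) (a : B), a ⊗ₜ[ℂ] K 0 i ∈ LieAlgebra.center ℂ (B ⊗[ℂ] τ) :=
    fun i a => tmul_mem_center (hτ.K_zero_mem_center i) a
  refine ⟨fun z => ⟨fun hz => ?_, fun hz => ?_⟩, fun hB_inf hfin => hB_inf ?_⟩
  · obtain ⟨f, hf, rfl⟩ := exists_sum_of_mem_center hz
    refine Submodule.sum_mem _ fun b _ => ?_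
    have h := hτ.mem_span_K_zero_of_mem_center (by omega) hfree (hf b)
    obtain ⟨c, hc⟩ := (Submodule.mem_span_range_iff_exists_fun ℂ).1 h
    beta_reduce
    rw [← hc, TensorProduct.tmul_sum]
    refine Submodule.sum_mem _ fun i _ => ?_
    rw [TensorProduct.tmul_smul]
    exact Submodule.smul_mem _ _ (Submodule.subset_span ⟨i, b, rfl⟩)
  · induction hz using Submodule.span_induction with
    | mem w hw =>
      obtain ⟨i, a, rfl⟩ := hw
      exact hcenter i a
    | zero => exact zero_mem _
    | add x y _ _ hx hy => exact add_mem hx hy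
    | smul c x _ hx => exact (LieAlgebra.center ℂ (B ⊗[ℂ] τ)).smul_mem c hx
  · let i : Fin n := ⟨0, by omega⟩
    let g : B →ₗ[ℂ] ↥(LieAlgebra.center ℂ (B ⊗[ℂ] τ)) :=
      LinearMap.codRestrict (LieAlgebra.center ℂ (B ⊗[ℂ] τ)).toSubmodule
        ((TensorProduct.mk ℂ B τ).flip (K 0 i)) (hcenter i)
    refine FiniteDimensional.of_injective g fun a a' h => ?_
    exact tmul_left_injective (hfree.K_ne_zero (m := 0) (j := i) rfl) (congrArg Subtype.val h)

end MT
end
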